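/- Let G be a finite group, M a Mackey functor over G, and H_1, …, H_r a list of subgroups of G containing exactly one from each conjugacy class. For each subgroup H ≤ G, the assignment [x] ↦ [n_H^G θ_M(x)] — where n_H^G θ_M(x) ∈ T(M)(G/G) is represented by the pair (G/H → ∗ →= ∗, x) — gives a well-defined homomorphism Ξ_M(H) : (Φ^H M)/W(H) → Φ^G T^{|G/H|}(M) of abelian groups. The induced graded ring homomorphism Ξ_M : Sym(⊕_{i=1}^r (Φ^{H_i} M)/W(H_i)) → Φ^G T(M), where Sym denotes the symmetric algebra over ℤ and the summand (Φ^{H_i} M)/W(H_i) is placed in degree |G/H_i|, is an isomorphism of graded rings. That is, the geometric fixed points of the free Tambara functor on M form the free symmetric algebra on the geometric fixed points of M with respect to all subgroups, quotiented by the actions of their Weyl groups. -/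

import Mathlib

set_option autoImplicit false

namespace Tamb

variable {G : Type} [Group G]

/-- A function between `G`-sets is equivariant. -/
def IsEquivariant (G : Type) [Group G] {A B : Type} [SMul G A] [SMul G B] (f : A → B) : Prop :=
  ∀ (g : G) (a : A), f (g • a) = g • f a

section Maps

variable {X Y Z : Type} [MulAction G X] [MulAction G Y] [MulAction G Z]

/-- The identity equivariant map. -/
def gid (G X : Type) [Group G] [MulAction G X] : X →[G] X :=
  ⟨fun x => x, fun _ _ => rfl⟩

@[simp] theorem gid_apply (x : X) : gid G X x = x := rfl

/-- Composition of equivariant maps. -/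
def gcomp (j : Y →[G] Z) (i : X →[G] Y) : X →[G] Z :=
  ⟨fun x => j (i x), fun g x => by
    show j (i (g • x)) = g • j (i x)
    rw [MulActionHom.map_smul, MulActionHom.map_smul]⟩

@[simp] theorem gcomp_apply (j : Y →[G] Z) (i : X →[G] Y) (x : X) : gcomp j i x = j (i x) := rfl

/-- The pullback of two equivariant maps of `G`-sets. -/
def Pb (f : X →[G] Z) (g : Y →[G] Z) : Type := {p : X × Y // f p.1 = g p.2}

namespace Pb

variable (f : X →[G] Z) (g : Y →[G] Z)

instance : SMul G (Pb f g) :=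
  ⟨fun a p => ⟨(a • p.1.1, a • p.1.2), by
    rw [MulActionHom.map_smul, MulActionHom.map_smul, p.2]⟩⟩

instance : MulAction G (Pb f g) where
  one_smul p := Subtype.ext (Prod.ext (one_smul _ _) (one_smul _ _))
  mul_smul a b p := Subtype.ext (Prod.ext (mul_smul _ _ _) (mul_smul _ _ _))

instance [Finite X] [Finite Y] : Finite (Pb f g) := Subtype.finite

/-- First projection of a pullback. -/
def fstHom : Pb f g →[G] X := ⟨fun p => p.1.1, fun _ _ => rfl⟩
/-- Second projection of a pullback. -/
def sndHom : Pb f g →[G] Y := ⟨fun p => p.1.2, fun _ _ => rfl⟩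

@[simp] theorem fstHom_apply (p : Pb f g) : fstHom f g p = p.1.1 := rfl
@[simp] theorem sndHom_apply (p : Pb f g) : sndHom f g p = p.1.2 := rfl

end Pb

/-- `Sec i j` is the set `∏_{i,j} X` of sections of `i : X → Y` defined on fibers
of `j : Y → Z`: an element is a point `z : Z` together with a section of `i`
defined on `j⁻¹(z)`. -/
structure Sec (i : X →[G] Y) (j : Y →[G] Z) where
  pt : Z
  sec : ∀ y : Y, j y = pt → X
  isSec : ∀ (y : Y) (h : j y = pt), i (sec y h) = y

namespace Sec

variable {i : X →[G] Y} {j : Y →[G] Z}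

theorem ext' {σ τ : Sec i j} (h1 : σ.pt = τ.pt)
    (h2 : ∀ (y : Y) (h : j y = σ.pt) (h' : j y = τ.pt), σ.sec y h = τ.sec y h') : σ = τ := by
  obtain ⟨p, s, hs⟩ := σ
  obtain ⟨p', s', hs'⟩ := τ
  dsimp at h1
  subst h1
  have hss : s = s' := by
    funext y hy
    exact h2 y hy hy
  subst hss
  rfl

theorem sec_congr (σ : Sec i j) {y y' : Y} (e : y = y') {h : j y = σ.pt} {h' : j y' = σ.pt} :
    σ.sec y h = σ.sec y' h' := by subst e; rfl

instance : SMul G (Sec i j) :=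
  ⟨fun a σ =>
    { pt := a • σ.pt
      sec := fun y h => a • σ.sec (a⁻¹ • y) (by rw [MulActionHom.map_smul, h, inv_smul_smul])
      isSec := fun y h => by
        rw [MulActionHom.map_smul, σ.isSec, smul_inv_smul] }⟩

@[simp] theorem smul_pt (a : G) (σ : Sec i j) : (a • σ).pt = a • σ.pt := rfl

theorem smul_sec (a : G) (σ : Sec i j) (y : Y) (h : j y = (a • σ).pt)
    (h' : j (a⁻¹ • y) = σ.pt) : (a • σ).sec y h = a • σ.sec (a⁻¹ • y) h' := rfl

instance : MulAction G (Sec i j) where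
  one_smul σ := by
    refine ext' (one_smul _ _) (fun y h h' => ?_)
    have h'' : j ((1 : G)⁻¹ • y) = σ.pt := by rw [inv_one, one_smul]; exact h'
    rw [smul_sec 1 σ y h h'', one_smul]
    exact sec_congr σ (by rw [inv_one, one_smul])
  mul_smul a b σ := by
    refine ext' (mul_smul _ _ _) (fun y h h' => ?_)
    have h1 : j ((a * b)⁻¹ • y) = σ.pt := by
      rw [MulActionHom.map_smul, h]
      exact inv_smul_smul _ _
    have h2 : j (a⁻¹ • y) = (b • σ).pt := by
      rw [MulActionHom.map_smul, h']
      show a⁻¹ • (a • (b • σ).pt) = _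
      exact inv_smul_smul _ _
    have h3 : j (b⁻¹ • (a⁻¹ • y)) = σ.pt := by
      rw [MulActionHom.map_smul, h2]
      exact inv_smul_smul _ _
    rw [smul_sec (a * b) σ y h h1, smul_sec a (b • σ) y h' h2, smul_sec b σ (a⁻¹ • y) h2 h3,
      mul_smul]
    exact congrArg (a • ·) (congrArg (b • ·) (sec_congr σ (by rw [mul_inv_rev, mul_smul])))

instance optionFinite {X : Type} [Finite X] : Finite (Option X) :=
  Finite.of_equiv (X ⊕ PUnit.{1}) (Equiv.optionEquivSumPUnit.{0,0} X).symm

instance [Finite X] [Finite Y] [Finite Z] : Finite (Sec i j) := by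
  classical
  have hF : Function.Injective (fun σ : Sec i j =>
      ((σ.pt, fun y => if h : j y = σ.pt then some (σ.sec y h) else none) :
        Z × (Y → Option X))) := by
    intro σ τ he
    have h1 : σ.pt = τ.pt := congrArg Prod.fst he
    refine ext' h1 (fun y hy hy' => ?_)
    have h2 := congrFun (congrArg Prod.snd he) y
    dsimp only at h2
    rw [dif_pos hy, dif_pos hy'] at h2
    exact Option.some_injective _ h2
  exact Finite.of_injective _ hF

end Sec

/-- The canonical projection `∏_{i,j} X → Z`. -/
def pHom (i : X →[G] Y) (j : Y →[G] Z) : Sec i j →[G] Z :=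
  ⟨fun σ => σ.pt, fun _ _ => rfl⟩

@[simp] theorem pHom_apply (i : X →[G] Y) (j : Y →[G] Z) (σ : Sec i j) :
    pHom i j σ = σ.pt := rfl

/-- The canonical pullback `Y ×_Z ∏_{i,j} X`. -/
abbrev ECan (i : X →[G] Y) (j : Y →[G] Z) : Type := Pb j (pHom i j)

/-- The evaluation map `e : Y ×_Z ∏_{i,j} X → X`. -/
def eval (i : X →[G] Y) (j : Y →[G] Z) : ECan i j → X := fun q => q.1.2.sec q.1.1 q.2

theorem eval_smul (i : X →[G] Y) (j : Y →[G] Z) (a : G) (q : ECan i j) :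
    eval i j (a • q) = a • eval i j q := by
  have h1 : j (a • q.1.1) = (a • q.1.2).pt := by
    rw [MulActionHom.map_smul, q.2]; rfl
  have h2 : j (a⁻¹ • (a • q.1.1)) = q.1.2.pt := by rw [inv_smul_smul]; exact q.2
  calc eval i j (a • q) = (a • q.1.2).sec (a • q.1.1) h1 := rfl
    _ = a • q.1.2.sec (a⁻¹ • (a • q.1.1)) h2 := Sec.smul_sec _ _ _ _ _
    _ = a • q.1.2.sec q.1.1 q.2 := congrArg (a • ·) (Sec.sec_congr _ (inv_smul_smul a q.1.1))

/-- The evaluation map as an equivariant map. -/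
def evalHom (i : X →[G] Y) (j : Y →[G] Z) : ECan i j →[G] X :=
  ⟨eval i j, eval_smul i j⟩

/-- The projection `π₂ : Y ×_Z ∏_{i,j} X → ∏_{i,j} X` of the canonical exponential diagram. -/
def pi2Hom (i : X →[G] Y) (j : Y →[G] Z) : ECan i j →[G] Sec i j :=
  Pb.sndHom j (pHom i j)

end Maps

/-- `(f, g, h)` is a distributor for `(i, j)`: the diagram with bottom row
`X →i Y →j Z`, top row `g : A → B`, left vertical `f : A → X` and right vertical
`h : B → Z` is an exponential diagram, i.e. it is isomorphic (by equivariant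
bijections fixing the bottom row) to the canonical diagram built from `∏_{i,j} X`. -/
def IsDistributor {X Y Z A B : Type} [MulAction G X] [MulAction G Y] [MulAction G Z]
    [MulAction G A] [MulAction G B]
    (i : X →[G] Y) (j : Y →[G] Z) (f : A →[G] X) (g : A →[G] B) (h : B →[G] Z) : Prop :=
  ∃ (α : A ≃ ECan i j) (β : B ≃ Sec i j),
    IsEquivariant G ⇑α ∧ IsEquivariant G ⇑β ∧
    (∀ a, eval i j (α a) = f a) ∧
    (∀ a, β (g a) = (α a).1.2) ∧
    (∀ b, (β b).pt = h b)
section CoreB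

/-- A (bundled) finite `G`-set. -/
structure FinGSet (G : Type) [Group G] : Type 1 where
  carrier : Type
  [fin : Finite carrier]
  [act : MulAction G carrier]

attribute [instance] FinGSet.fin FinGSet.act

instance : MulAction G Empty where
  smul _ e := e.elim
  one_smul e := e.elim
  mul_smul _ _ e := e.elim

/-- Bundle a finite `G`-set. -/
def mkG (G : Type) [Group G] (A : Type) [MulAction G A] [Finite A] : FinGSet G := ⟨A⟩

/-- The empty `G`-set. -/
def emptyG (G : Type) [Group G] : FinGSet G := ⟨Empty⟩
/-- The one-point `G`-set (`G/G`). -/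
def ptG (G : Type) [Group G] : FinGSet G := ⟨PUnit⟩
/-- Binary coproduct of finite `G`-sets. -/
def sumG (X Y : FinGSet G) : FinGSet G := ⟨X.carrier ⊕ Y.carrier⟩
/-- Binary product of finite `G`-sets. -/
def prodG (X Y : FinGSet G) : FinGSet G := ⟨X.carrier × Y.carrier⟩

def initHom (X : FinGSet G) : (emptyG G).carrier →[G] X.carrier :=
  ⟨fun e => e.elim, fun _ e => e.elim⟩
def toPtHom (X : FinGSet G) : X.carrier →[G] (ptG G).carrier :=
  ⟨fun _ => PUnit.unit, fun _ _ => rfl⟩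
def inlHom (X Y : FinGSet G) : X.carrier →[G] (sumG X Y).carrier :=
  ⟨Sum.inl, fun _ _ => rfl⟩
def inrHom (X Y : FinGSet G) : Y.carrier →[G] (sumG X Y).carrier :=
  ⟨Sum.inr, fun _ _ => rfl⟩
def sumMapHom {X Y X' Y' : FinGSet G} (f : X.carrier →[G] X'.carrier)
    (g : Y.carrier →[G] Y'.carrier) : (sumG X Y).carrier →[G] (sumG X' Y').carrier :=
  ⟨Sum.map f g, fun a x => by
    cases x with
    | inl v => show Sum.inl (f (a • v)) = Sum.inl (a • f v); rw [MulActionHom.map_smul]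
    | inr v => show Sum.inr (g (a • v)) = Sum.inr (a • g v); rw [MulActionHom.map_smul]⟩
def sumElimHom {X Y Z : FinGSet G} (f : X.carrier →[G] Z.carrier)
    (g : Y.carrier →[G] Z.carrier) : (sumG X Y).carrier →[G] Z.carrier :=
  ⟨Sum.elim f g, fun a x => by
    cases x with
    | inl v => show f (a • v) = a • f v; rw [MulActionHom.map_smul]
    | inr v => show g (a • v) = a • g v; rw [MulActionHom.map_smul]⟩
/-- The fold map `X ⊔ X → X`. -/
def foldHom (X : FinGSet G) : (sumG X X).carrier →[G] X.carrier :=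
  sumElimHom (gid G X.carrier) (gid G X.carrier)
def prodMapHom {X Y X' Y' : FinGSet G} (f : X.carrier →[G] X'.carrier)
    (g : Y.carrier →[G] Y'.carrier) : (prodG X Y).carrier →[G] (prodG X' Y').carrier :=
  ⟨Prod.map f g, fun a x => Prod.ext (MulActionHom.map_smul f a x.1) (MulActionHom.map_smul g a x.2)⟩
def pi1Hom (X Y : FinGSet G) : (prodG X Y).carrier →[G] X.carrier :=
  ⟨Prod.fst, fun _ _ => rfl⟩
def pi2ProdHom (X Y : FinGSet G) : (prodG X Y).carrier →[G] Y.carrier :=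
  ⟨Prod.snd, fun _ _ => rfl⟩

/-- A semi-Mackey functor over `G` (with set values): restrictions and transfers,
functorial, converting coproducts into products, and satisfying the pullback
(Mackey double coset) condition. -/
structure SemiMackey (G : Type) [Group G] : Type 2 where
  obj : FinGSet G → Type 1
  nonempty : ∀ X, Nonempty (obj X)
  res : ∀ {X Y : FinGSet G}, (X.carrier →[G] Y.carrier) → obj Y → obj X
  tr : ∀ {X Y : FinGSet G}, (X.carrier →[G] Y.carrier) → obj X → obj Y
  res_id : ∀ {X : FinGSet G} (x : obj X), res (gid G X.carrier) x = x
  res_comp : ∀ {X Y Z : FinGSet G} (i : X.carrier →[G] Y.carrier)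
    (j : Y.carrier →[G] Z.carrier) (z : obj Z), res i (res j z) = res (gcomp j i) z
  tr_id : ∀ {X : FinGSet G} (x : obj X), tr (gid G X.carrier) x = x
  tr_comp : ∀ {X Y Z : FinGSet G} (i : X.carrier →[G] Y.carrier)
    (j : Y.carrier →[G] Z.carrier) (x : obj X), tr j (tr i x) = tr (gcomp j i) x
  mackey : ∀ {X Y Z : FinGSet G} (j : X.carrier →[G] Z.carrier)
    (i : Y.carrier →[G] Z.carrier) (y : obj Y),
    res j (tr i y) =
      tr (X := mkG G (Pb j i)) (Pb.fstHom j i) (res (X := mkG G (Pb j i)) (Pb.sndHom j i) y)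
  sum_bij : ∀ (X Y : FinGSet G),
    Function.Bijective (fun z : obj (sumG X Y) => (res (inlHom X Y) z, res (inrHom X Y) z))
  empty_subsingleton : Subsingleton (obj (emptyG G))

/-- A semi-Tambara functor over `G`: a semi-Mackey functor with multiplicative
norms, commuting with restrictions over pullbacks and satisfying the
distributive law over exponential diagrams. -/
structure SemiTambara (G : Type) [Group G] extends SemiMackey G : Type 2 where
  nm : ∀ {X Y : FinGSet G}, (X.carrier →[G] Y.carrier) → obj X → obj Y
  nm_id : ∀ {X : FinGSet G} (x : obj X), nm (gid G X.carrier) x = x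
  nm_comp : ∀ {X Y Z : FinGSet G} (i : X.carrier →[G] Y.carrier)
    (j : Y.carrier →[G] Z.carrier) (x : obj X), nm j (nm i x) = nm (gcomp j i) x
  nm_res : ∀ {X Y Z : FinGSet G} (j : X.carrier →[G] Z.carrier)
    (i : Y.carrier →[G] Z.carrier) (y : obj Y),
    res j (nm i y) =
      nm (X := mkG G (Pb j i)) (Pb.fstHom j i) (res (X := mkG G (Pb j i)) (Pb.sndHom j i) y)
  distrib : ∀ {X Y Z A B : FinGSet G} (i : X.carrier →[G] Y.carrier)
    (j : Y.carrier →[G] Z.carrier) (f : A.carrier →[G] X.carrier)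
    (g : A.carrier →[G] B.carrier) (h : B.carrier →[G] Z.carrier),
    IsDistributor i j f g h → ∀ x : obj X, nm j (tr i x) = tr h (nm g (res f x))

/-- The element of `M(X ⊔ Y)` corresponding to a pair `(x, y)`. -/
noncomputable def SemiMackey.pairElt (M : SemiMackey G) {X Y : FinGSet G}
    (x : M.obj X) (y : M.obj Y) : M.obj (sumG X Y) :=
  (Equiv.ofBijective _ (M.sum_bij X Y)).symm (x, y)

/-- The addition on `M(X)` induced by transfer along the fold map. -/
noncomputable def SemiMackey.add (M : SemiMackey G) {X : FinGSet G} (x y : M.obj X) : M.obj X :=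
  M.tr (foldHom X) (M.pairElt x y)

/-- The zero of `M(X)`: the transfer of the unique element of `M(∅)`. -/
noncomputable def SemiMackey.zero (M : SemiMackey G) (X : FinGSet G) : M.obj X :=
  M.tr (initHom X) (M.nonempty (emptyG G)).some

/-- The multiplication on `R(X)` induced by the norm along the fold map. -/
noncomputable def SemiTambara.mul (R : SemiTambara G) {X : FinGSet G} (x y : R.obj X) :
    R.obj X :=
  R.nm (foldHom X) (R.toSemiMackey.pairElt x y)

/-- The multiplicative unit of `R(X)`: the norm of the unique element of `R(∅)`. -/
noncomputable def SemiTambara.one (R : SemiTambara G) (X : FinGSet G) : R.obj X :=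
  R.nm (initHom X) (R.nonempty (emptyG G)).some

/-- A Mackey functor: a semi-Mackey functor all of whose values are abelian
groups under the transfer-induced addition. -/
structure Mackey (G : Type) [Group G] extends SemiMackey G : Type 2 where
  hasNeg : ∀ (X : FinGSet G) (x : obj X), ∃ y, toSemiMackey.add x y = toSemiMackey.zero X

/-- A Tambara functor: a semi-Tambara functor all of whose values are abelian
groups under the transfer-induced addition. -/
structure Tambara (G : Type) [Group G] extends SemiTambara G : Type 2 where
  hasNeg : ∀ (X : FinGSet G) (x : obj X),
    ∃ y, toSemiMackey.add x y = toSemiMackey.zero X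

/-- A map of semi-Mackey functors. -/
structure SMackHom {G : Type} [Group G] (M N : SemiMackey G) : Type 1 where
  app : ∀ X, M.obj X → N.obj X
  app_res : ∀ {X Y : FinGSet G} (f : X.carrier →[G] Y.carrier) (y : M.obj Y),
    app X (M.res f y) = N.res f (app Y y)
  app_tr : ∀ {X Y : FinGSet G} (f : X.carrier →[G] Y.carrier) (x : M.obj X),
    app Y (M.tr f x) = N.tr f (app X x)

/-- A map of semi-Tambara functors. -/
structure STambHom {G : Type} [Group G] (M N : SemiTambara G) extends
    SMackHom M.toSemiMackey N.toSemiMackey : Type 1 where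
  app_nm : ∀ {X Y : FinGSet G} (f : X.carrier →[G] Y.carrier) (x : M.obj X),
    app Y (M.nm f x) = N.nm f (app X x)

/-- A formal "transfer of a norm of an element of `M`": a pair
`(U →i V →j X, u ∈ M(U))`. -/
structure PreT {G : Type} [Group G] (M : SemiMackey G) (X : FinGSet G) : Type 1 where
  U : FinGSet G
  V : FinGSet G
  i : U.carrier →[G] V.carrier
  j : V.carrier →[G] X.carrier
  u : M.obj U

/-- Two pairs are isomorphic. -/
def IsoRel (M : SemiMackey G) (X : FinGSet G) (a b : PreT M X) : Prop :=
  ∃ (f : b.U.carrier ≃ a.U.carrier) (g : b.V.carrier ≃ a.V.carrier)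
    (hf : IsEquivariant G ⇑f) (_ : IsEquivariant G ⇑g),
    (∀ u' : b.U.carrier, a.i (f u') = g (b.i u')) ∧
    (∀ v' : b.V.carrier, a.j (g v') = b.j v') ∧
    M.res (MulActionHom.mk ⇑f hf) a.u = b.u

/-- The relation defining the free semi-Tambara functor `sT(M)`: pairs are
identified up to isomorphism and the distributive-law relation. -/
inductive STRel (M : SemiMackey G) (X : FinGSet G) : PreT M X → PreT M X → Prop
  | iso {a b : PreT M X} : IsoRel M X a b → STRel M X a b
  | distrib {W U V A B : FinGSet G} (k : W.carrier →[G] U.carrier)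
      (i : U.carrier →[G] V.carrier) (j : V.carrier →[G] X.carrier)
      (f : A.carrier →[G] W.carrier) (g : A.carrier →[G] B.carrier)
      (h : B.carrier →[G] V.carrier) :
      IsDistributor k i f g h → ∀ w : M.obj W,
      STRel M X ⟨U, V, i, j, M.tr k w⟩ ⟨A, B, g, gcomp j h, M.res f w⟩

/-- The value of the free semi-Tambara functor on `M` at `X`. -/
def sT (M : SemiMackey G) (X : FinGSet G) : Type 1 := Quot (STRel M X)

/-- The universal map `θ_M : M → sT(M)`, at the level of representatives. -/
def thetaPre (M : SemiMackey G) (X : FinGSet G) (x : M.obj X) : PreT M X :=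
  ⟨X, X, gid G X.carrier, gid G X.carrier, x⟩

/-- Transfer on representatives: postcomposition. -/
def trPre (M : SemiMackey G) {X Y : FinGSet G} (f : X.carrier →[G] Y.carrier)
    (a : PreT M X) : PreT M Y :=
  ⟨a.U, a.V, a.i, gcomp f a.j, a.u⟩

/-- Restriction on representatives: pull back both maps. -/
def resPre (M : SemiMackey G) {X Y : FinGSet G} (f : Y.carrier →[G] X.carrier)
    (a : PreT M X) : PreT M Y where
  U := mkG G (Pb a.i (Pb.fstHom a.j f))
  V := mkG G (Pb a.j f)
  i := Pb.sndHom a.i (Pb.fstHom a.j f)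
  j := Pb.sndHom a.j f
  u := M.res (X := mkG G (Pb a.i (Pb.fstHom a.j f))) (Pb.fstHom a.i (Pb.fstHom a.j f)) a.u

/-- Norm on representatives, via the canonical exponential diagram for `(j, f)`. -/
def normPre (M : SemiMackey G) {X Y : FinGSet G} (f : X.carrier →[G] Y.carrier)
    (a : PreT M X) : PreT M Y where
  U := mkG G (Pb a.i (evalHom a.j f))
  V := mkG G (Sec a.j f)
  i := gcomp (pi2Hom a.j f) (Pb.sndHom a.i (evalHom a.j f))
  j := pHom a.j f
  u := M.res (X := mkG G (Pb a.i (evalHom a.j f))) (Pb.fstHom a.i (evalHom a.j f)) a.u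

/-- Addition on representatives: disjoint union. -/
noncomputable def addPre (M : SemiMackey G) {X : FinGSet G} (a b : PreT M X) : PreT M X where
  U := sumG a.U b.U
  V := sumG a.V b.V
  i := sumMapHom a.i b.i
  j := sumElimHom a.j b.j
  u := M.pairElt a.u b.u

/-- A pair has (pure) degree `n` if every fiber of its first map has exactly `n`
elements. -/
def DegN {M : SemiMackey G} {X : FinGSet G} (n : ℕ) (a : PreT M X) : Prop :=
  ∀ v : a.V.carrier, Nat.card {u : a.U.carrier // a.i u = v} = n

/-- A finite `G`-set over `X` (a representative for the Burnside semi-Mackey functor). -/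
structure BurnPre (G : Type) [Group G] (X : FinGSet G) : Type 1 where
  A : FinGSet G
  f : A.carrier →[G] X.carrier

/-- Isomorphism of finite `G`-sets over `X`. -/
def BurnIso {X : FinGSet G} (s t : BurnPre G X) : Prop :=
  ∃ (e : s.A.carrier ≃ t.A.carrier) (_ : IsEquivariant G ⇑e), ∀ x, t.f (e x) = s.f x

/-- The pair `(∅ → A →f X, 0)` associated to a `G`-set over `X`. -/
noncomputable def bPair (M : SemiMackey G) {X : FinGSet G} (s : BurnPre G X) : PreT M X :=
  ⟨emptyG G, s.A, initHom s.A, s.f, (M.nonempty (emptyG G)).some⟩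

end CoreB



section Statement9

variable {G : Type} [Group G] [Finite G]

/-- The orbit `G/K` as a finite `G`-set. -/
def quotG (G : Type) [Group G] [Finite G] (K : Subgroup G) : FinGSet G := ⟨G ⧸ K⟩

/-- The canonical projection `G/K → G/H` for `K ≤ H`. -/
def projHom {K H : Subgroup G} (hKH : K ≤ H) :
    (quotG G K).carrier →[G] (quotG G H).carrier :=
  ⟨Quotient.map' id (fun a b hab => by
      rw [QuotientGroup.leftRel_apply] at hab ⊢
      exact hKH hab),
   fun g x => by induction x using Quotient.inductionOn' with | h a => rfl⟩

/-- Sums of transfers from proper subgroups in a Tambara functor, at level `G/G`. -/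
inductive TransSetT (T : Tambara G) : T.obj (ptG G) → Prop
  | zero : TransSetT T (T.toSemiMackey.zero (ptG G))
  | tr (K : Subgroup G) (hK : K ≠ ⊤) (y : T.obj (quotG G K)) :
      TransSetT T (T.tr (toPtHom (quotG G K)) y)
  | add {a b : T.obj (ptG G)} : TransSetT T a → TransSetT T b →
      TransSetT T (T.toSemiMackey.add a b)

/-- The relation defining the geometric fixed points `Φ^G T`. -/
def relPhiT (T : Tambara G) (a b : T.obj (ptG G)) : Prop :=
  ∃ s t, TransSetT T s ∧ TransSetT T t ∧
    T.toSemiMackey.add a s = T.toSemiMackey.add b t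

/-- Sums of transfers from proper subgroups of `H` in a Mackey functor, at level `G/H`. -/
inductive TransSetM (M : Mackey G) (H : Subgroup G) : M.obj (quotG G H) → Prop
  | zero : TransSetM M H (M.toSemiMackey.zero (quotG G H))
  | tr (K : Subgroup G) (hK : K < H) (y : M.obj (quotG G K)) :
      TransSetM M H (M.tr (projHom hK.le) y)
  | add {a b : M.obj (quotG G H)} : TransSetM M H a → TransSetM M H b →
      TransSetM M H (M.toSemiMackey.add a b)

/-- The relation defining the geometric fixed points `Φ^H M`. -/
def relPhiM (M : Mackey G) (H : Subgroup G) (x y : M.obj (quotG G H)) : Prop :=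
  ∃ s t, TransSetM M H s ∧ TransSetM M H t ∧
    M.toSemiMackey.add x s = M.toSemiMackey.add y t

/-- The relation identifying two elements of `M(G/H)` in the same orbit of the Weyl
group `W(H) = Aut_G(G/H)`. -/
def relWM (M : Mackey G) (H : Subgroup G) (x y : M.obj (quotG G H)) : Prop :=
  ∃ (w : (quotG G H).carrier ≃ (quotG G H).carrier) (hw : IsEquivariant G ⇑w),
    y = M.res (MulActionHom.mk ⇑w hw) x

/-- The pair `(G/K → ∗ →= ∗, x)` representing `n_K^G θ_M(x)`. -/
def XiPre (M : Mackey G) (K : Subgroup G) (x : M.obj (quotG G K)) :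
    PreT M.toSemiMackey (ptG G) :=
  ⟨quotG G K, ptG G, toPtHom (quotG G K), gid G (ptG G).carrier, x⟩

set_option linter.unusedSectionVars false
set_option linter.unusedVariables false

theorem ghom_ext {X Y : FinGSet G} {f g : X.carrier →[G] Y.carrier} (h : ∀ x, f x = g x) :
    f = g := MulActionHom.ext h

theorem gcomp_gid {X Y : FinGSet G} (f : X.carrier →[G] Y.carrier) :
    gcomp f (gid G X.carrier) = f := ghom_ext fun _ => rfl

theorem gid_gcomp {X Y : FinGSet G} (f : X.carrier →[G] Y.carrier) :
    gcomp (gid G Y.carrier) f = f := ghom_ext fun _ => rfl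

/-- The pullback as a bundled finite `G`-set. -/
abbrev pbG {X Y Z : FinGSet G} (j : X.carrier →[G] Z.carrier) (i : Y.carrier →[G] Z.carrier) :
    FinGSet G := mkG G (Pb j i)

abbrev pfst {X Y Z : FinGSet G} (j : X.carrier →[G] Z.carrier) (i : Y.carrier →[G] Z.carrier) :
    (pbG j i).carrier →[G] X.carrier := Pb.fstHom j i

abbrev psnd {X Y Z : FinGSet G} (j : X.carrier →[G] Z.carrier) (i : Y.carrier →[G] Z.carrier) :
    (pbG j i).carrier →[G] Y.carrier := Pb.sndHom j i

/-- The inverse of a bijective equivariant map. -/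
noncomputable def invHom {X Y : FinGSet G} (e : X.carrier →[G] Y.carrier)
    (he : Function.Bijective e) : Y.carrier →[G] X.carrier :=
  ⟨(Equiv.ofBijective e he).symm, fun g y => by
    apply he.1
    rw [MulActionHom.map_smul]
    show (Equiv.ofBijective e he) _ = g • (Equiv.ofBijective e he) _
    rw [Equiv.apply_symm_apply, Equiv.apply_symm_apply]⟩

theorem apply_invHom {X Y : FinGSet G} (e : X.carrier →[G] Y.carrier)
    (he : Function.Bijective e) (y : Y.carrier) : e (invHom e he y) = y :=
  (Equiv.ofBijective e he).apply_symm_apply y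

/-- The sub-`G`-set of a product cut out by an invariant relation. -/
def RelPb {X Y : FinGSet G} (r : X.carrier × Y.carrier → Prop)
    (_ : ∀ (g : G) p, r p → r (g • p)) : Type := {p : X.carrier × Y.carrier // r p}

namespace RelPb

variable {X Y : FinGSet G} (r : X.carrier × Y.carrier → Prop)
  (hr : ∀ (g : G) p, r p → r (g • p))

instance : SMul G (RelPb r hr) := ⟨fun a p => ⟨(a • p.1.1, a • p.1.2), hr a p.1 p.2⟩⟩

instance : MulAction G (RelPb r hr) where
  one_smul p := Subtype.ext (Prod.ext (one_smul _ _) (one_smul _ _))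
  mul_smul a b p := Subtype.ext (Prod.ext (mul_smul _ _ _) (mul_smul _ _ _))

instance : Finite (RelPb r hr) := Subtype.finite

def fst : (mkG G (RelPb r hr)).carrier →[G] X.carrier :=
  ⟨fun p => p.1.1, fun _ _ => rfl⟩

def snd : (mkG G (RelPb r hr)).carrier →[G] Y.carrier :=
  ⟨fun p => p.1.2, fun _ _ => rfl⟩

end RelPb

namespace SemiMackey

variable (M : SemiMackey G)

theorem tr_res_pb_eq {X Y Z : FinGSet G} (j : X.carrier →[G] Z.carrier)
    (i : Y.carrier →[G] Z.carrier) (hr : ∀ (g : G) p,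
      (fun p : X.carrier × Y.carrier => j p.1 = i p.2) p →
      (fun p : X.carrier × Y.carrier => j p.1 = i p.2) (g • p)) (y : M.obj Y) :
    M.res j (M.tr i y) =
      M.tr (RelPb.fst (fun p : X.carrier × Y.carrier => j p.1 = i p.2) hr)
        (M.res (RelPb.snd (fun p : X.carrier × Y.carrier => j p.1 = i p.2) hr) y) :=
  M.mackey j i y

theorem res_tr_congr {X Y Z Z' : FinGSet G} (j : X.carrier →[G] Z.carrier)
    (i : Y.carrier →[G] Z.carrier) (j' : X.carrier →[G] Z'.carrier)
    (i' : Y.carrier →[G] Z'.carrier) (h : ∀ x y, j x = i y ↔ j' x = i' y) (y : M.obj Y) :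
    M.res j (M.tr i y) = M.res j' (M.tr i' y) := by
  have key : ∀ r r' : X.carrier × Y.carrier → Prop, r = r' → ∀ hr hr',
      M.tr (RelPb.fst r hr) (M.res (RelPb.snd r hr) y) =
        M.tr (RelPb.fst r' hr') (M.res (RelPb.snd r' hr') y) := by
    rintro r r' rfl hr hr'
    rfl
  rw [tr_res_pb_eq M j i, tr_res_pb_eq M j' i']
  · exact key _ _ (funext fun p => propext (h p.1 p.2)) _ _
  · intro g p hp
    show j' (g • p.1) = i' (g • p.2)
    rw [MulActionHom.map_smul, MulActionHom.map_smul]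
    exact congrArg _ hp
  · intro g p hp
    show j (g • p.1) = i (g • p.2)
    rw [MulActionHom.map_smul, MulActionHom.map_smul]
    exact congrArg _ hp

theorem res_tr_of_injective {X Z : FinGSet G} (e : X.carrier →[G] Z.carrier)
    (he : Function.Injective e) (x : M.obj X) : M.res e (M.tr e x) = x := by
  rw [M.res_tr_congr e e (gid G X.carrier) (gid G X.carrier) fun x y => he.eq_iff,
    M.tr_id, M.res_id]

theorem tr_res_of_bijective {X Z : FinGSet G} (e : X.carrier →[G] Z.carrier)
    (he : Function.Bijective e) (z : M.obj Z) : M.tr e (M.res e z) = z := by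
  have h : M.tr e (M.tr (invHom e he) z) = z := by
    rw [M.tr_comp, show gcomp e (invHom e he) = gid G Z.carrier from
      ghom_ext (apply_invHom e he), M.tr_id]
  conv_lhs => rw [← h, M.res_tr_of_injective e he.1]
  exact h

/-- The Mackey condition for an arbitrary pullback square. -/
theorem res_tr_of_pullback {P X Y Z : FinGSet G} (j : X.carrier →[G] Z.carrier)
    (i : Y.carrier →[G] Z.carrier) (p : P.carrier →[G] X.carrier)
    (q : P.carrier →[G] Y.carrier) (hc : ∀ w, j (p w) = i (q w))
    (hinj : ∀ w w', p w = p w' → q w = q w' → w = w')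
    (hsur : ∀ x y, j x = i y → ∃ w, p w = x ∧ q w = y) (y : M.obj Y) :
    M.res j (M.tr i y) = M.tr p (M.res q y) := by
  let e : P.carrier →[G] (pbG j i).carrier :=
    ⟨fun w => ⟨(p w, q w), hc w⟩, fun g w => Subtype.ext
      (Prod.ext (MulActionHom.map_smul p g w) (MulActionHom.map_smul q g w))⟩
  have he : Function.Bijective e := by
    constructor
    · intro w w' h
      have h' := congrArg Subtype.val h
      exact hinj w w' (congrArg Prod.fst h') (congrArg Prod.snd h')
    · rintro ⟨⟨x, y⟩, h⟩
      obtain ⟨w, rfl, rfl⟩ := hsur x y h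
      exact ⟨w, rfl⟩
  have h1 := M.mackey j i y
  have h2 := M.tr_res_of_bijective e he (M.res (psnd j i) y)
  rw [M.res_comp] at h2
  refine h1.trans ?_
  refine (congrArg (M.tr (pfst j i)) h2.symm).trans ?_
  rw [M.tr_comp]
  rfl

theorem res_comp_apply {X Y Z : FinGSet G} (i : X.carrier →[G] Y.carrier)
    (j : Y.carrier →[G] Z.carrier) (k : X.carrier →[G] Z.carrier) (h : ∀ x, j (i x) = k x)
    (z : M.obj Z) : M.res i (M.res j z) = M.res k z := by
  rw [M.res_comp]
  exact congrArg (fun f => M.res f z) (ghom_ext h)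

theorem tr_comp_apply {X Y Z : FinGSet G} (i : X.carrier →[G] Y.carrier)
    (j : Y.carrier →[G] Z.carrier) (k : X.carrier →[G] Z.carrier) (h : ∀ x, j (i x) = k x)
    (x : M.obj X) : M.tr j (M.tr i x) = M.tr k x := by
  rw [M.tr_comp]
  exact congrArg (fun f => M.tr f x) (ghom_ext h)

theorem tr_res_comp_of_bijective {X Y Z : FinGSet G} (e : X.carrier →[G] Y.carrier)
    (he : Function.Bijective e) (f : Y.carrier →[G] Z.carrier) (y : M.obj Y) :
    M.tr (gcomp f e) (M.res e y) = M.tr f y := by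
  rw [← M.tr_comp, M.tr_res_of_bijective e he]

theorem res_inl_pairElt {X Y : FinGSet G} (x : M.obj X) (y : M.obj Y) :
    M.res (inlHom X Y) (M.pairElt x y) = x :=
  congrArg Prod.fst ((Equiv.ofBijective _ (M.sum_bij X Y)).apply_symm_apply (x, y))

theorem res_inr_pairElt {X Y : FinGSet G} (x : M.obj X) (y : M.obj Y) :
    M.res (inrHom X Y) (M.pairElt x y) = y :=
  congrArg Prod.snd ((Equiv.ofBijective _ (M.sum_bij X Y)).apply_symm_apply (x, y))

theorem sum_ext {X Y : FinGSet G} {z w : M.obj (sumG X Y)}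
    (h1 : M.res (inlHom X Y) z = M.res (inlHom X Y) w)
    (h2 : M.res (inrHom X Y) z = M.res (inrHom X Y) w) : z = w :=
  (M.sum_bij X Y).1 (Prod.ext h1 h2)

theorem eq_pairElt {X Y : FinGSet G} (z : M.obj (sumG X Y)) :
    z = M.pairElt (M.res (inlHom X Y) z) (M.res (inrHom X Y) z) :=
  M.sum_ext (M.res_inl_pairElt _ _).symm (M.res_inr_pairElt _ _).symm

theorem empty_eq (x y : M.obj (emptyG G)) : x = y :=
  M.empty_subsingleton.elim x y

theorem tr_sumMap {X Y X' Y' : FinGSet G} (f : X.carrier →[G] X'.carrier)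
    (g : Y.carrier →[G] Y'.carrier) (x : M.obj X) (y : M.obj Y) :
    M.tr (sumMapHom f g) (M.pairElt x y) = M.pairElt (M.tr f x) (M.tr g y) := by
  apply M.sum_ext
  · rw [M.res_inl_pairElt, M.res_tr_of_pullback (inlHom X' Y') (sumMapHom f g) f (inlHom X Y)
      (fun _ => rfl), M.res_inl_pairElt]
    · intro w w' _ h
      exact Sum.inl_injective h
    · rintro x (y | y) h
      · exact ⟨y, (Sum.inl_injective h).symm, rfl⟩
      · cases h
  · rw [M.res_inr_pairElt, M.res_tr_of_pullback (inrHom X' Y') (sumMapHom f g) g (inrHom X Y)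
      (fun _ => rfl), M.res_inr_pairElt]
    · intro w w' _ h
      exact Sum.inr_injective h
    · rintro x (y | y) h
      · cases h
      · exact ⟨y, (Sum.inr_injective h).symm, rfl⟩

theorem res_sumMap {X Y X' Y' : FinGSet G} (f : X.carrier →[G] X'.carrier)
    (g : Y.carrier →[G] Y'.carrier) (x : M.obj X') (y : M.obj Y') :
    M.res (sumMapHom f g) (M.pairElt x y) = M.pairElt (M.res f x) (M.res g y) := by
  apply M.sum_ext
  · rw [M.res_inl_pairElt, M.res_comp]
    refine Eq.trans ?_ (congrArg (M.res f) (M.res_inl_pairElt x y))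
    rw [M.res_comp]
    rfl
  · rw [M.res_inr_pairElt, M.res_comp]
    refine Eq.trans ?_ (congrArg (M.res g) (M.res_inr_pairElt x y))
    rw [M.res_comp]
    rfl

theorem add_tr_tr {X Y Z : FinGSet G} (f : X.carrier →[G] Z.carrier)
    (g : Y.carrier →[G] Z.carrier) (x : M.obj X) (y : M.obj Y) :
    M.add (M.tr f x) (M.tr g y) = M.tr (sumElimHom f g) (M.pairElt x y) := by
  rw [SemiMackey.add, ← M.tr_sumMap, M.tr_comp_apply]
  rintro (x | x) <;> rfl

theorem tr_add {X Z : FinGSet G} (f : X.carrier →[G] Z.carrier) (x y : M.obj X) :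
    M.tr f (M.add x y) = M.add (M.tr f x) (M.tr f y) := by
  rw [add_tr_tr, SemiMackey.add, M.tr_comp_apply]
  rintro (x | x) <;> rfl

/-- Decomposition of a transfer along a coproduct decomposition of its source. -/
theorem tr_eq_add {A B X Z : FinGSet G} (a : A.carrier →[G] X.carrier)
    (b : B.carrier →[G] X.carrier) (h : Function.Bijective (sumElimHom a b))
    (q : X.carrier →[G] Z.carrier) (y : M.obj X) :
    M.tr q y = M.add (M.tr (gcomp q a) (M.res a y)) (M.tr (gcomp q b) (M.res b y)) := by
  rw [add_tr_tr, ← M.tr_res_comp_of_bijective _ h q y, M.eq_pairElt (M.res (sumElimHom a b) y),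
    M.res_comp, M.res_comp]
  refine congrArg₂ (fun f => M.tr f) (ghom_ext ?_) rfl
  rintro (x | x) <;> rfl

theorem res_add {X Z : FinGSet G} (f : X.carrier →[G] Z.carrier) (x y : M.obj Z) :
    M.res f (M.add x y) = M.add (M.res f x) (M.res f y) := by
  rw [SemiMackey.add, SemiMackey.add, ← M.res_sumMap,
    M.res_tr_of_pullback f (foldHom Z) (foldHom X) (sumMapHom f f)]
  · rintro (x | x) <;> rfl
  · rintro (x | x) (x' | x') h h'
    · exact congrArg Sum.inl h
    · cases h'
    · cases h'
    · exact congrArg Sum.inr h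
  · rintro x (y | y) h
    · exact ⟨Sum.inl x, rfl, congrArg Sum.inl h⟩
    · exact ⟨Sum.inr x, rfl, congrArg Sum.inr h⟩

theorem zero_add' {X : FinGSet G} (x : M.obj X) : M.add (M.zero X) x = x := by
  have h := M.tr_eq_add (initHom X) (gid G X.carrier)
    ⟨by rintro (a | a) (b | b) h
        · exact a.elim
        · exact a.elim
        · exact b.elim
        · exact congrArg Sum.inr h, fun x => ⟨Sum.inr x, rfl⟩⟩ (gid G X.carrier) x
  rw [gid_gcomp, gid_gcomp, M.tr_id, M.res_id, M.tr_id] at h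
  rw [SemiMackey.zero, M.empty_eq (M.nonempty (emptyG G)).some (M.res (initHom X) x)]
  exact h.symm

theorem add_comm' {X : FinGSet G} (x y : M.obj X) : M.add x y = M.add y x := by
  have h := M.tr_eq_add (inrHom X X) (inlHom X X)
    ⟨by rintro (a | a) (b | b) h
        · exact congrArg Sum.inl (Sum.inr_injective h)
        · cases h
        · cases h
        · exact congrArg Sum.inr (Sum.inl_injective h), by
      rintro (a | a)
      exacts [⟨Sum.inr a, rfl⟩, ⟨Sum.inl a, rfl⟩]⟩ (foldHom X) (M.pairElt x y)
  rw [M.res_inl_pairElt, M.res_inr_pairElt] at h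
  refine h.trans ?_
  rw [show gcomp (foldHom X) (inrHom X X) = gid G X.carrier from ghom_ext fun _ => rfl,
    show gcomp (foldHom X) (inlHom X X) = gid G X.carrier from ghom_ext fun _ => rfl,
    M.tr_id, M.tr_id]

theorem add_assoc' {X : FinGSet G} (x y z : M.obj X) :
    M.add (M.add x y) z = M.add x (M.add y z) := by
  let a : X.carrier →[G] (sumG (sumG X X) X).carrier := gcomp (inlHom _ _) (inlHom _ _)
  let b : (sumG X X).carrier →[G] (sumG (sumG X X) X).carrier :=
    sumElimHom (gcomp (inlHom _ _) (inrHom _ _)) (inrHom _ _)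
  have h := M.tr_eq_add a b
    ⟨by rintro (a | (a | a)) (b | (b | b)) h <;> cases h <;> rfl, by
      rintro ((a | a) | a)
      exacts [⟨Sum.inl a, rfl⟩, ⟨Sum.inr (Sum.inl a), rfl⟩, ⟨Sum.inr (Sum.inr a), rfl⟩]⟩
    (sumElimHom (foldHom X) (gid G X.carrier)) (M.pairElt (M.pairElt x y) z)
  have h1 : M.res a (M.pairElt (M.pairElt x y) z) = x := by
    rw [← M.res_comp, M.res_inl_pairElt, M.res_inl_pairElt]
  have h2 : M.res b (M.pairElt (M.pairElt x y) z) = M.pairElt y z := by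
    apply M.sum_ext
    · rw [M.res_inl_pairElt, M.res_comp,
        show gcomp b (inlHom X X) = gcomp (inlHom _ _) (inrHom _ _) from ghom_ext fun _ => rfl,
        ← M.res_comp, M.res_inl_pairElt, M.res_inr_pairElt]
    · rw [M.res_inr_pairElt, M.res_comp,
        show gcomp b (inrHom X X) = inrHom _ _ from ghom_ext fun _ => rfl, M.res_inr_pairElt]
  rw [h1, h2, show gcomp (sumElimHom (foldHom X) (gid G X.carrier)) a = gid G X.carrier from
    ghom_ext fun _ => rfl, M.tr_id, show gcomp (sumElimHom (foldHom X) (gid G X.carrier)) b =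
    foldHom X from ghom_ext (by rintro (x | x) <;> rfl), ← M.add_tr_tr, M.tr_id] at h
  exact h

/-- The additive monoid structure on the values of a semi-Mackey functor. -/
@[reducible] noncomputable def addCommMonoid (X : FinGSet G) : AddCommMonoid (M.obj X) :=
  letI : Zero (M.obj X) := ⟨M.zero X⟩
  letI : Add (M.obj X) := ⟨M.add⟩
  { add_assoc := M.add_assoc'
    zero_add := M.zero_add'
    add_zero := fun x => (M.add_comm' _ _).trans (M.zero_add' x)
    add_comm := M.add_comm'
    nsmul := nsmulRec }

end SemiMackey

/-- Invariance of a subset of a `G`-set. -/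
def Inv {X : FinGSet G} (S : Set X.carrier) : Prop := ∀ (g : G) (x : X.carrier), x ∈ S → g • x ∈ S

section Invariant

variable {X Y : FinGSet G}

theorem Inv.empty : Inv (∅ : Set X.carrier) := fun _ _ h => h.elim

theorem Inv.univ : Inv (Set.univ : Set X.carrier) := fun _ _ _ => trivial

theorem Inv.orbit (x : X.carrier) : Inv (MulAction.orbit G x) := by
  rintro g _ ⟨h, rfl⟩
  exact ⟨g * h, mul_smul _ _ _⟩

theorem Inv.union {S T : Set X.carrier} (hS : Inv S) (hT : Inv T) : Inv (S ∪ T) :=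
  fun g x h => h.imp (hS g x) (hT g x)

theorem Inv.inter {S T : Set X.carrier} (hS : Inv S) (hT : Inv T) : Inv (S ∩ T) :=
  fun g x h => ⟨hS g x h.1, hT g x h.2⟩

theorem Inv.mem_smul_iff {S : Set X.carrier} (hS : Inv S) (g : G) (x : X.carrier) :
    g • x ∈ S ↔ x ∈ S :=
  ⟨fun h => by simpa using hS g⁻¹ _ h, hS g x⟩

theorem Inv.diff {S T : Set X.carrier} (hS : Inv S) (hT : Inv T) : Inv (S \ T) :=
  fun g x h => ⟨hS g x h.1, fun h' => h.2 ((hT.mem_smul_iff g x).1 h')⟩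

theorem Inv.preimage {S : Set Y.carrier} (hS : Inv S) (f : X.carrier →[G] Y.carrier) :
    Inv (f ⁻¹' S) := fun g x h => by
  show f (g • x) ∈ S
  rw [MulActionHom.map_smul]
  exact hS g _ h

theorem Inv.image {S : Set X.carrier} (hS : Inv S) (f : X.carrier →[G] Y.carrier) :
    Inv (f '' S) := by
  rintro g _ ⟨x, hx, rfl⟩
  exact ⟨g • x, hS g x hx, MulActionHom.map_smul f g x⟩

theorem Inv.range (f : X.carrier →[G] Y.carrier) : Inv (Set.range f) := by
  rw [← Set.image_univ]
  exact Inv.univ.image f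

theorem Inv.orbit_subset {S : Set X.carrier} (hS : Inv S) {x : X.carrier} (hx : x ∈ S) :
    MulAction.orbit G x ⊆ S := by
  rintro _ ⟨g, rfl⟩
  exact hS g x hx

theorem Inv.singleton {x : X.carrier} (hx : ∀ g : G, g • x = x) : Inv {x} := by
  rintro g y rfl
  exact hx g

theorem mem_orbit_of_mem {x y : X.carrier} (h : y ∈ MulAction.orbit G x) :
    x ∈ MulAction.orbit G y := MulAction.mem_orbit_symm.1 h

/-- Induction on invariant subsets by adding one orbit at a time. -/
theorem inv_induction {p : Set X.carrier → Prop} (h0 : p ∅)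
    (h1 : ∀ (R : Set X.carrier) (x : X.carrier), Inv R → p R →
      Disjoint R (MulAction.orbit G x) → p (R ∪ MulAction.orbit G x)) :
    ∀ S : Set X.carrier, Inv S → p S := by
  have key : ∀ (n : ℕ) (S : Set X.carrier), S.ncard = n → Inv S → p S := by
    intro n
    induction n using Nat.strong_induction_on with
    | _ n ih =>
      intro S hn hS
      rcases S.eq_empty_or_nonempty with rfl | ⟨x, hx⟩
      · exact h0
      · have hsub := hS.orbit_subset hx
        have hlt : (S \ MulAction.orbit G x).ncard < n := by
          rw [← hn]
          exact Set.ncard_lt_ncard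
            ⟨Set.sdiff_subset, fun h => (h hx).2 (MulAction.mem_orbit_self x)⟩ (Set.toFinite _)
        have := h1 _ x (hS.diff (Inv.orbit x)) (ih _ hlt _ rfl (hS.diff (Inv.orbit x)))
          Set.disjoint_sdiff_left
        rwa [Set.sdiff_union_of_subset hsub] at this
  exact fun S hS => key _ S rfl hS

end Invariant

/-- An invariant subset as a finite `G`-set. -/
def InvSub {X : FinGSet G} (S : Set X.carrier) (_ : Inv S) : Type := {x : X.carrier // x ∈ S}

section InvSub

variable {X : FinGSet G} (S : Set X.carrier) (hS : Inv S)

instance : SMul G (InvSub S hS) := ⟨fun g x => ⟨g • x.1, hS g x.1 x.2⟩⟩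

instance : MulAction G (InvSub S hS) where
  one_smul x := Subtype.ext (one_smul _ _)
  mul_smul a b x := Subtype.ext (mul_smul _ _ _)

instance : Finite (InvSub S hS) := Subtype.finite

/-- An invariant subset as a bundled finite `G`-set. -/
abbrev subG : FinGSet G := mkG G (InvSub S hS)

/-- The inclusion of an invariant subset. -/
def inclHom : (subG S hS).carrier →[G] X.carrier := ⟨fun x => x.1, fun _ _ => rfl⟩

theorem inclHom_injective : Function.Injective (inclHom S hS) := fun _ _ h => Subtype.ext h

theorem range_inclHom : Set.range (inclHom S hS) = S :=
  Set.ext fun x => ⟨by rintro ⟨y, rfl⟩; exact y.2, fun h => ⟨⟨x, h⟩, rfl⟩⟩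

/-- Restriction of an equivariant map to invariant subsets. -/
def codHom {Y : FinGSet G} (f : Y.carrier →[G] X.carrier) (h : ∀ y, f y ∈ S) :
    Y.carrier →[G] (subG S hS).carrier :=
  ⟨fun y => ⟨f y, h y⟩, fun g y => Subtype.ext (MulActionHom.map_smul f g y)⟩

end InvSub

section BasePoint

/-- The base point of `G/K`. -/
def bp (K : Subgroup G) : (quotG G K).carrier := ((1 : G) : G ⧸ K)

theorem exists_smul_bp {K : Subgroup G} (x : (quotG G K).carrier) : ∃ g : G, x = g • bp K := by
  induction x using Quotient.inductionOn' with
  | h g => exact ⟨g, congrArg (fun a : G => (a : G ⧸ K)) (mul_one g).symm⟩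

theorem smul_bp_eq {K : Subgroup G} (g : G) : g • bp K = bp K ↔ g ∈ K := by
  show (((g * 1 : G) : G ⧸ K) = ((1 : G) : G ⧸ K)) ↔ _
  rw [mul_one, eq_comm, QuotientGroup.eq]
  simp

theorem smul_bp_eq_smul_bp {K : Subgroup G} (a b : G) : a • bp K = b • bp K ↔ a⁻¹ * b ∈ K := by
  rw [← smul_bp_eq, mul_smul, inv_smul_eq_iff, eq_comm]

theorem hom_quot_ext {K : Subgroup G} {X : FinGSet G} {f f' : (quotG G K).carrier →[G] X.carrier}
    (h : f (bp K) = f' (bp K)) : f = f' := by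
  refine ghom_ext fun x => ?_
  obtain ⟨g, rfl⟩ := exists_smul_bp x
  rw [MulActionHom.map_smul, MulActionHom.map_smul, h]

/-- The equivariant map `G/K → X` determined by a `K`-fixed point. -/
def ofFix {K : Subgroup G} {X : FinGSet G} (x : X.carrier) (h : ∀ g ∈ K, g • x = x) :
    (quotG G K).carrier →[G] X.carrier :=
  ⟨Quotient.lift (fun g : G => g • x) (fun a b hab => by
      have := h _ (QuotientGroup.leftRel_apply.1 hab)
      rw [mul_smul, inv_smul_eq_iff] at this
      exact this.symm),
   fun g y => by
      induction y using Quotient.inductionOn' with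
      | h a => exact mul_smul g a x⟩

theorem ofFix_bp {K : Subgroup G} {X : FinGSet G} (x : X.carrier) (h : ∀ g ∈ K, g • x = x) :
    ofFix x h (bp K) = x := one_smul G x

theorem hom_quot_injective {K : Subgroup G} {X : FinGSet G}
    (f : (quotG G K).carrier →[G] X.carrier) (h : ∀ g : G, g • f (bp K) = f (bp K) → g ∈ K) :
    Function.Injective f := by
  intro a b hab
  obtain ⟨a, rfl⟩ := exists_smul_bp a
  obtain ⟨b, rfl⟩ := exists_smul_bp b
  rw [MulActionHom.map_smul, MulActionHom.map_smul, eq_comm, ← inv_smul_eq_iff, ← mul_smul] at hab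
  exact (smul_bp_eq_smul_bp a b).2 (h _ hab)

theorem range_hom_quot {K : Subgroup G} {X : FinGSet G}
    (f : (quotG G K).carrier →[G] X.carrier) : Set.range f = MulAction.orbit G (f (bp K)) := by
  ext y
  constructor
  · rintro ⟨a, rfl⟩
    obtain ⟨a, rfl⟩ := exists_smul_bp a
    exact ⟨a, (MulActionHom.map_smul f a (bp K)).symm⟩
  · rintro ⟨a, rfl⟩
    exact ⟨a • bp K, MulActionHom.map_smul f a (bp K)⟩

end BasePoint

/-- Additive characters on the geometric fixed points of `M`, modulo the Weyl group actions,
for one subgroup in each conjugacy class. -/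
structure FixChar (M : Mackey G) (ι S : Type) [CommRing S] where
  H : ι → Subgroup G
  hH : ∀ K : Subgroup G, ∃! i : ι, ∃ g : G, Subgroup.map (MulAut.conj g).toMonoidHom K = H i
  ψ : ∀ i : ι, M.obj (quotG G (H i)) → S
  rel : ∀ (i : ι) (x y : M.obj (quotG G (H i))),
    (relPhiM M (H i) x y ∨ relWM M (H i) x y) → ψ i x = ψ i y
  map_add : ∀ (i : ι) (x y : M.obj (quotG G (H i))),
    ψ i (M.toSemiMackey.add x y) = ψ i x + ψ i y

namespace FixChar

variable {M : Mackey G} {ι S : Type} [CommRing S] (D : FixChar M ι S)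

theorem exists_chart {U : FinGSet G} (x : U.carrier) :
    ∃ (i : ι) (f : (quotG G (D.H i)).carrier →[G] U.carrier),
      Function.Injective f ∧ Set.range f = MulAction.orbit G x := by
  obtain ⟨i, ⟨g, hg⟩, -⟩ := D.hH (MulAction.stabilizer G x)
  have hmem : ∀ a : G, a ∈ D.H i ↔ a • (g • x) = g • x := by
    intro a
    rw [← hg, Subgroup.mem_map_equiv, MulAction.mem_stabilizer_iff]
    simp only [MulAut.conj_symm_apply, mul_smul, inv_smul_eq_iff]
  refine ⟨i, ofFix (g • x) fun a ha => (hmem a).1 ha, ?_, ?_⟩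
  · apply hom_quot_injective
    rw [ofFix_bp]
    exact fun a ha => (hmem a).2 ha
  · rw [range_hom_quot, ofFix_bp]
    exact MulAction.orbit_eq_iff.2 ⟨g, rfl⟩

theorem chart_unique {U : FinGSet G} {i j : ι} (f : (quotG G (D.H i)).carrier →[G] U.carrier)
    (f' : (quotG G (D.H j)).carrier →[G] U.carrier) (hf : Function.Injective f)
    (hf' : Function.Injective f') (h : Set.range f = Set.range f') (u : M.obj U) :
    D.ψ i (M.res f u) = D.ψ j (M.res f' u) := by
  have hst : ∀ (l : ι) (f : (quotG G (D.H l)).carrier →[G] U.carrier), Function.Injective f →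
      ∀ a : G, a ∈ D.H l ↔ a • f (bp _) = f (bp _) := by
    intro l f hf a
    rw [← MulActionHom.map_smul, hf.eq_iff, smul_bp_eq]
  have hij : i = j := by
    have hmem : f' (bp _) ∈ Set.range f := h ▸ ⟨_, rfl⟩
    rw [range_hom_quot] at hmem
    obtain ⟨g, hg⟩ := hmem
    refine (D.hH (D.H i)).unique ⟨1, ?_⟩ ⟨g, ?_⟩
    · ext a
      rw [Subgroup.mem_map_equiv]
      simp only [MulAut.conj_symm_apply, inv_one, one_mul, mul_one]
    · ext a
      rw [Subgroup.mem_map_equiv, hst i f hf, hst j f' hf', ← hg]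
      simp only [MulAut.conj_symm_apply, mul_smul, inv_smul_eq_iff]
  subst hij
  have hmem : ∀ x, ∃ y, f y = f' x := fun x => by
    have : f' x ∈ Set.range f := h ▸ ⟨x, rfl⟩
    exact this
  have hmem' : ∀ x, ∃ y, f' y = f x := fun x => by
    have : f x ∈ Set.range f' := h ▸ ⟨x, rfl⟩
    exact this
  choose w hw using hmem
  choose w' hw' using hmem'
  let e : (quotG G (D.H i)).carrier ≃ (quotG G (D.H i)).carrier :=
    ⟨w, w', fun x => hf' (by rw [hw', hw]), fun x => hf (by rw [hw, hw'])⟩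
  have he : IsEquivariant G ⇑e := fun g x => hf (by
    show f (w (g • x)) = f (g • w x)
    rw [hw, MulActionHom.map_smul, MulActionHom.map_smul, hw])
  refine D.rel i _ _ (Or.inr ⟨e, he, ?_⟩)
  exact (M.res_comp_apply _ _ _ hw u).symm

open Classical in
/-- The value of the character on the restriction of `u` to an orbit. -/
noncomputable def val {U : FinGSet G} (u : M.obj U) (O : Set U.carrier) : S :=
  if h : ∃ (i : ι) (f : (quotG G (D.H i)).carrier →[G] U.carrier),
      Function.Injective f ∧ Set.range f = O
  then D.ψ h.choose (M.res h.choose_spec.choose u) else 1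

theorem val_range {U : FinGSet G} (u : M.obj U) {i : ι}
    (f : (quotG G (D.H i)).carrier →[G] U.carrier) (hf : Function.Injective f) :
    D.val u (Set.range f) = D.ψ i (M.res f u) := by
  have h : ∃ (i : ι) (f' : (quotG G (D.H i)).carrier →[G] U.carrier),
      Function.Injective f' ∧ Set.range f' = Set.range f := ⟨i, f, hf, rfl⟩
  rw [val, dif_pos h]
  exact D.chart_unique _ _ h.choose_spec.choose_spec.1 hf h.choose_spec.choose_spec.2 u

/-- The product of the values of the character over the orbits in an invariant subset. -/
noncomputable def prod {U : FinGSet G} (u : M.obj U) (R : Set U.carrier) : S :=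
  ∏ᶠ O ∈ (fun x => MulAction.orbit G x) '' R, D.val u O

theorem prod_empty {U : FinGSet G} (u : M.obj U) : D.prod u ∅ = 1 := by
  rw [prod, Set.image_empty, finprod_mem_empty]

theorem prod_union {U : FinGSet G} (u : M.obj U) {R R' : Set U.carrier} (hR : Inv R)
    (h : Disjoint R R') : D.prod u (R ∪ R') = D.prod u R * D.prod u R' := by
  rw [prod, Set.image_union, finprod_mem_union _ (Set.toFinite _) (Set.toFinite _)]
  · rfl
  · rw [Set.disjoint_left]
    rintro _ ⟨x, hx, rfl⟩ ⟨y, hy, hxy⟩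
    have : y ∈ MulAction.orbit G x := by
      dsimp only at hxy
      rw [← hxy]
      exact MulAction.mem_orbit_self y
    exact Set.disjoint_left.1 h (hR.orbit_subset hx this) hy

theorem prod_range {U : FinGSet G} (u : M.obj U) {i : ι}
    (f : (quotG G (D.H i)).carrier →[G] U.carrier) (hf : Function.Injective f) :
    D.prod u (Set.range f) = D.ψ i (M.res f u) := by
  rw [← D.val_range u f hf, prod]
  have : (fun x => MulAction.orbit G x) '' Set.range f = {Set.range f} := by
    ext O
    constructor
    · rintro ⟨_, ⟨x, rfl⟩, rfl⟩
      obtain ⟨g, rfl⟩ := exists_smul_bp x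
      rw [Set.mem_singleton_iff, range_hom_quot, MulActionHom.map_smul]
      exact MulAction.orbit_eq_iff.2 ⟨g, rfl⟩
    · rintro rfl
      exact ⟨f (bp _), ⟨_, rfl⟩, (range_hom_quot f).symm⟩
  rw [this, finprod_mem_singleton]

theorem prod_res_image {U' U : FinGSet G} (e : U'.carrier →[G] U.carrier) (u : M.obj U)
    (R : Set U'.carrier) (hR : Inv R) :
    Set.InjOn e R → D.prod (M.res e u) R = D.prod u (e '' R) := by
  refine inv_induction (p := fun R => Set.InjOn e R →
    D.prod (M.res e u) R = D.prod u (e '' R)) ?_ ?_ R hR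
  · intro _
    rw [Set.image_empty, prod_empty, prod_empty]
  · intro R x hR ih hd he
    rw [Set.image_union, prod_union D _ hR hd, prod_union D _ (hR.image e),
      ih (he.mono Set.subset_union_left)]
    · congr 1
      obtain ⟨i, f, hf, hr⟩ := D.exists_chart x
      rw [← hr, prod_range D _ f hf, ← Set.range_comp]
      have hinj : Function.Injective (gcomp e f) := by
        intro a b hab
        refine hf (he (Or.inr ?_) (Or.inr ?_) hab)
        · rw [← hr]; exact ⟨a, rfl⟩
        · rw [← hr]; exact ⟨b, rfl⟩
      rw [M.res_comp, ← prod_range D u (gcomp e f) hinj]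
      rfl
    · rw [Set.disjoint_left]
      rintro _ ⟨a, ha, rfl⟩ ⟨b, hb, hab⟩
      have := he (Or.inr hb) (Or.inl ha) hab
      subst this
      exact Set.disjoint_left.1 hd ha hb

theorem prod_res_bijOn {U' U : FinGSet G} (e : U'.carrier →[G] U.carrier) (u : M.obj U)
    {R : Set U'.carrier} {R' : Set U.carrier} (hR : Inv R) (h : Set.BijOn e R R') :
    D.prod (M.res e u) R = D.prod u R' := by
  rw [D.prod_res_image e u R hR h.injOn, h.image_eq]

end FixChar

theorem finsum_mem_mul_finsum_mem {α β S : Type*} [Finite α] [Finite β] [CommRing S]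
    (A : Set α) (B : Set β) (f : α → S) (g : β → S) :
    (∑ᶠ a ∈ A, f a) * (∑ᶠ b ∈ B, g b) = ∑ᶠ p ∈ A ×ˢ B, f p.1 * g p.2 := by
  classical
  rw [finsum_mem_eq_finite_toFinset_sum _ (Set.toFinite A),
    finsum_mem_eq_finite_toFinset_sum _ (Set.toFinite B),
    finsum_mem_eq_finite_toFinset_sum _ (Set.toFinite (A ×ˢ B)), Finset.sum_mul_sum,
    ← Finset.sum_product']
  refine Finset.sum_congr ?_ fun _ _ => rfl
  ext p
  simp

theorem sumElim_incl_bijective {X : FinGSet G} {R O : Set X.carrier} (hR : Inv R) (hO : Inv O)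
    (hd : Disjoint R O) :
    Function.Bijective (sumElimHom
      (codHom (R ∪ O) (hR.union hO) (inclHom R hR) fun x => Or.inl x.2)
      (codHom (R ∪ O) (hR.union hO) (inclHom O hO) fun x => Or.inr x.2)) := by
  constructor
  · rintro (a | a) (b | b) h
    · have h' : a.1 = b.1 :=
        congrArg (fun z : (subG (R ∪ O) (hR.union hO)).carrier => z.1) h
      exact congrArg Sum.inl (Subtype.ext h')
    · have h' : a.1 = b.1 := congrArg Subtype.val h
      exact (Set.disjoint_left.1 hd a.2 (h' ▸ b.2)).elim
    · have h' : a.1 = b.1 := congrArg Subtype.val h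
      exact (Set.disjoint_left.1 hd b.2 (h' ▸ a.2)).elim
    · have h' : a.1 = b.1 :=
        congrArg (fun z : (subG (R ∪ O) (hR.union hO)).carrier => z.1) h
      exact congrArg Sum.inr (Subtype.ext h')
  · rintro ⟨x, hx | hx⟩
    · exact ⟨Sum.inl ⟨x, hx⟩, rfl⟩
    · exact ⟨Sum.inr ⟨x, hx⟩, rfl⟩

/-- Every nonempty `G`-orbit over `G/H` is of the form `G/K` with `K ≤ H`. -/
theorem exists_orbit_chart {H : Subgroup G} {Q : FinGSet G}
    (q : Q.carrier →[G] (quotG G H).carrier) (x : Q.carrier) :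
    ∃ (K : Subgroup G) (hK : K ≤ H) (e : (quotG G K).carrier →[G] Q.carrier),
      Function.Injective e ∧ Set.range e = MulAction.orbit G x ∧
      ∀ a, q (e a) = projHom hK a := by
  obtain ⟨g, hg⟩ := exists_smul_bp (q x)
  have hx' : q (g⁻¹ • x) = bp H := by rw [MulActionHom.map_smul, hg, inv_smul_smul]
  have hK : MulAction.stabilizer G (g⁻¹ • x) ≤ H := by
    intro a ha
    rw [← smul_bp_eq, ← hx', ← MulActionHom.map_smul, MulAction.mem_stabilizer_iff.1 ha]
  let e : (quotG G (MulAction.stabilizer G (g⁻¹ • x))).carrier →[G] Q.carrier :=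
    ofFix (g⁻¹ • x) fun a ha => MulAction.mem_stabilizer_iff.1 ha
  have he : e (bp _) = g⁻¹ • x := ofFix_bp _ _
  refine ⟨_, hK, e, ?_, ?_, ?_⟩
  · apply hom_quot_injective
    rw [he]
    exact fun a ha => ha
  · rw [range_hom_quot, he]
    exact MulAction.orbit_eq_iff.2 ⟨g⁻¹, rfl⟩
  · intro a
    have : gcomp q e = projHom hK := hom_quot_ext (by
      show q (e (bp _)) = _
      rw [he, hx']
      rfl)
    exact congrArg (fun f => f a) this

/-- The invariant subsets of `W` mapping bijectively to `R`. -/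
def lifts {W U : FinGSet G} (k : W.carrier →[G] U.carrier) (R : Set U.carrier) :
    Set (Set W.carrier) := {T | Inv T ∧ Set.BijOn k T R}

theorem orbit_eq_of_bijOn {H : Subgroup G} {Q : FinGSet G}
    (q : Q.carrier →[G] (quotG G H).carrier) {T : Set Q.carrier} (hT : Inv T)
    (h : Set.InjOn q T) {t : Q.carrier} (ht : t ∈ T) : T = MulAction.orbit G t := by
  refine subset_antisymm (fun s hs => ?_) (hT.orbit_subset ht)
  obtain ⟨a, ha⟩ := exists_smul_bp (q t)
  obtain ⟨b, hb⟩ := exists_smul_bp (q s)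
  refine ⟨b * a⁻¹, h (hT _ _ ht) hs ?_⟩
  rw [MulActionHom.map_smul, ha, hb, mul_smul, inv_smul_smul]

namespace FixChar

variable {M : Mackey G} {ι S : Type} [CommRing S] (D : FixChar M ι S)

theorem ψ_zero (i : ι) : D.ψ i (M.toSemiMackey.zero _) = 0 := by
  have := D.map_add i (M.toSemiMackey.zero _) (M.toSemiMackey.zero _)
  rw [M.toSemiMackey.zero_add'] at this
  simpa using this

theorem ψ_tr_of_lt (i : ι) {K : Subgroup G} (hK : K < D.H i) (y : M.obj (quotG G K)) :
    D.ψ i (M.tr (projHom hK.le) y) = 0 := by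
  rw [← D.ψ_zero i]
  exact D.rel i _ _ (Or.inl ⟨_, _, TransSetM.zero, TransSetM.tr K hK y,
    M.toSemiMackey.add_comm' _ _⟩)

theorem ψ_tr_orbit (i : ι) {Q : FinGSet G} (q : Q.carrier →[G] (quotG G (D.H i)).carrier)
    (y : M.obj Q) (x : Q.carrier) :
    D.ψ i (M.tr (gcomp q (inclHom _ (Inv.orbit x))) (M.res (inclHom _ (Inv.orbit x)) y)) =
      ∑ᶠ T ∈ {T | T ∈ lifts q Set.univ ∧ T ⊆ MulAction.orbit G x}, D.prod y T := by
  obtain ⟨K, hK, e, he, hr, hq⟩ := exists_orbit_chart q x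
  have hcod : ∀ a, e a ∈ MulAction.orbit G x := fun a => hr ▸ ⟨a, rfl⟩
  have hb : Function.Bijective (codHom _ (Inv.orbit x) e hcod) := by
    constructor
    · intro a b h
      exact he (congrArg Subtype.val h)
    · rintro ⟨z, hz⟩
      rw [← hr] at hz
      obtain ⟨a, rfl⟩ := hz
      exact ⟨a, rfl⟩
  rw [← M.tr_res_comp_of_bijective _ hb, M.res_comp_apply _ _ e fun _ => rfl,
    show gcomp (gcomp q (inclHom _ (Inv.orbit x))) (codHom _ (Inv.orbit x) e hcod) = projHom hK
      from ghom_ext hq]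
  rcases hK.lt_or_eq with hlt | rfl
  · rw [D.ψ_tr_of_lt i hlt, show {T | T ∈ lifts q Set.univ ∧ T ⊆ MulAction.orbit G x} = ∅ from ?_,
      finsum_mem_empty]
    rw [Set.eq_empty_iff_forall_notMem]
    rintro T ⟨⟨hT, hTb⟩, hTx⟩
    obtain ⟨t, ht, htq⟩ := hTb.surjOn (Set.mem_univ (bp (D.H i)))
    have hbp : e (bp K) ∈ T := by
      have h1 : e (bp K) ∈ MulAction.orbit G t := by
        rw [MulAction.orbit_eq_iff.2 (hTx ht)]
        exact hcod _
      exact hT.orbit_subset ht h1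
    refine hlt.not_ge fun h hh => ?_
    rw [← smul_bp_eq]
    apply he
    rw [MulActionHom.map_smul]
    refine hTb.injOn (hT _ _ hbp) hbp ?_
    rw [MulActionHom.map_smul, hq]
    exact (smul_bp_eq h).2 hh
  · have hid : projHom hK = gid G (quotG G (D.H i)).carrier := hom_quot_ext rfl
    rw [hid, M.tr_id, show {T | T ∈ lifts q Set.univ ∧ T ⊆ MulAction.orbit G x} =
      {MulAction.orbit G x} from ?_, finsum_mem_singleton, ← hr, D.prod_range y e he]
    rw [hid] at hq
    ext T
    constructor
    · rintro ⟨⟨hT, hTb⟩, hTx⟩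
      obtain ⟨t, ht, htq⟩ := hTb.surjOn (Set.mem_univ (bp (D.H i)))
      rw [Set.mem_singleton_iff, orbit_eq_of_bijOn q hT hTb.injOn ht]
      exact MulAction.orbit_eq_iff.2 (hTx ht)
    · rintro rfl
      refine ⟨⟨Inv.orbit x, fun _ _ => trivial, ?_, ?_⟩, subset_rfl⟩
      · rw [← hr]
        rintro _ ⟨a, rfl⟩ _ ⟨b, rfl⟩ hab
        rw [hq, hq] at hab
        exact congrArg e hab
      · intro a _
        exact ⟨e a, hcod a, hq a⟩

theorem ψ_tr_aux (i : ι) {Q : FinGSet G} (q : Q.carrier →[G] (quotG G (D.H i)).carrier)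
    (y : M.obj Q) (R : Set Q.carrier) (hR : Inv R) : ∀ hR' : Inv R,
    D.ψ i (M.tr (gcomp q (inclHom R hR')) (M.res (inclHom R hR') y)) =
      ∑ᶠ T ∈ {T | T ∈ lifts q Set.univ ∧ T ⊆ R}, D.prod y T := by
  refine inv_induction (p := fun R => ∀ hR' : Inv R,
    D.ψ i (M.tr (gcomp q (inclHom R hR')) (M.res (inclHom R hR') y)) =
      ∑ᶠ T ∈ {T | T ∈ lifts q Set.univ ∧ T ⊆ R}, D.prod y T) ?_ ?_ R hR
  · intro h
    rw [show {T | T ∈ lifts q Set.univ ∧ T ⊆ ∅} = ∅ from ?_, finsum_mem_empty]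
    · have hb : Function.Bijective (sumElimHom (gid G (subG _ h).carrier)
          (gid G (subG _ h).carrier)) :=
        ⟨by rintro (a | a) <;> exact a.2.elim, fun a => a.2.elim⟩
      have h2 := congrArg (D.ψ i) (M.tr_eq_add _ _ hb (gcomp q (inclHom ∅ h))
        (M.res (inclHom ∅ h) y))
      rw [D.map_add, gcomp_gid, M.res_id] at h2
      simpa using h2
    · rw [Set.eq_empty_iff_forall_notMem]
      rintro T ⟨⟨hT, hTb⟩, hTx⟩
      obtain ⟨t, ht, -⟩ := hTb.surjOn (Set.mem_univ (bp (D.H i)))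
      exact hTx ht
  · intro R x hR ih hd hR'
    have hO := Inv.orbit x
    rw [M.tr_eq_add _ _ (sumElim_incl_bijective hR hO hd), D.map_add,
      M.res_comp_apply _ _ (inclHom R hR) fun _ => rfl,
      M.res_comp_apply _ _ (inclHom _ hO) fun _ => rfl]
    refine (congrArg₂ (· + ·) (ih hR) (D.ψ_tr_orbit i q y x)).trans ?_
    rw [← finsum_mem_union _ (Set.toFinite _) (Set.toFinite _)]
    · refine congrArg (fun A => ∑ᶠ T ∈ A, D.prod y T) (Set.ext fun T => ⟨?_, ?_⟩)
      · rintro (h | h)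
        · exact ⟨h.1, h.2.trans Set.subset_union_left⟩
        · exact ⟨h.1, h.2.trans Set.subset_union_right⟩
      · rintro ⟨hT, hTR⟩
        obtain ⟨t, ht, -⟩ := hT.2.surjOn (Set.mem_univ (bp (D.H i)))
        have hTt := orbit_eq_of_bijOn q hT.1 hT.2.injOn ht
        refine (hTR ht).imp (fun h => ⟨hT, ?_⟩) (fun h => ⟨hT, ?_⟩)
        · rw [hTt]
          exact hR.orbit_subset h
        · rw [hTt]
          exact hO.orbit_subset h
    · rw [Set.disjoint_left]
      rintro T ⟨hT, h1⟩ ⟨-, h2⟩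
      obtain ⟨t, ht, -⟩ := hT.2.surjOn (Set.mem_univ (bp (D.H i)))
      exact Set.disjoint_left.1 hd (h1 ht) (h2 ht)

theorem ψ_tr (i : ι) {Q : FinGSet G} (q : Q.carrier →[G] (quotG G (D.H i)).carrier)
    (y : M.obj Q) : D.ψ i (M.tr q y) = ∑ᶠ T ∈ lifts q Set.univ, D.prod y T := by
  have hb : Function.Bijective (inclHom (Set.univ : Set Q.carrier) Inv.univ) :=
    ⟨inclHom_injective _ _, fun x => ⟨⟨x, trivial⟩, rfl⟩⟩
  rw [← M.tr_res_comp_of_bijective _ hb q y, D.ψ_tr_aux i q y _ Inv.univ]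
  simp only [Set.subset_univ, and_true, Set.ofPred_mem_eq]

theorem prod_tr_range {W U : FinGSet G} (k : W.carrier →[G] U.carrier) (w : M.obj W) {i : ι}
    (f : (quotG G (D.H i)).carrier →[G] U.carrier) (hf : Function.Injective f) :
    D.prod (M.tr k w) (Set.range f) = ∑ᶠ T ∈ lifts k (Set.range f), D.prod w T := by
  rw [D.prod_range _ f hf, M.mackey f k w]
  refine (D.ψ_tr i (pfst f k) (M.res (psnd f k) w)).trans ?_
  have hinj : Function.Injective (psnd f k) := by
    rintro ⟨⟨a, b⟩, h⟩ ⟨⟨a', b'⟩, h'⟩ hb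
    have hb' : b = b' := hb
    subst hb'
    have : a = a' := hf (Eq.trans h (Eq.symm h'))
    subst this
    rfl
  refine finsum_mem_eq_of_bijOn (fun T => psnd f k '' T) ⟨?_, ?_, ?_⟩ ?_
  · rintro T ⟨hT, hTb⟩
    refine ⟨hT.image _, ?_, ?_, ?_⟩
    · rintro _ ⟨p, hp, rfl⟩
      exact ⟨p.1.1, p.2⟩
    · rintro _ ⟨p, hp, rfl⟩ _ ⟨p', hp', rfl⟩ h
      have h1 : f p.1.1 = f p'.1.1 := p.2.trans (Eq.trans h p'.2.symm)
      rw [hTb.injOn hp hp' (hf h1)]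
    · rintro _ ⟨a, rfl⟩
      obtain ⟨p, hp, hpa⟩ := hTb.surjOn (Set.mem_univ a)
      have hpa' : p.1.1 = a := hpa
      refine ⟨_, ⟨p, hp, rfl⟩, ?_⟩
      rw [← hpa']
      exact p.2.symm
  · exact (Set.image_injective.2 hinj).injOn
  · rintro T ⟨hT, hTb⟩
    refine ⟨psnd f k ⁻¹' T, ⟨hT.preimage _, fun _ _ => trivial, ?_, ?_⟩, ?_⟩
    · intro p hp p' hp' h
      apply hinj
      refine hTb.injOn hp hp' ?_
      have h' : p.1.1 = p'.1.1 := h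
      exact p.2.symm.trans ((congrArg f h').trans p'.2)
    · intro a _
      obtain ⟨t, ht, hta⟩ := hTb.surjOn ⟨a, rfl⟩
      exact ⟨⟨(a, t), hta.symm⟩, ht, rfl⟩
    · refine Set.image_preimage_eq_of_subset fun t ht => ?_
      obtain ⟨a, ha⟩ := hTb.mapsTo ht
      exact ⟨⟨(a, t), ha⟩, rfl⟩
  · rintro T ⟨hT, hTb⟩
    exact D.prod_res_bijOn (psnd f k) w hT hinj.injOn.bijOn_image

theorem lifts_union_bijOn {W U : FinGSet G} (k : W.carrier →[G] U.carrier)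
    {R R' : Set U.carrier} (hR : Inv R) (hR' : Inv R') (hd : Disjoint R R') :
    Set.BijOn (fun p : Set W.carrier × Set W.carrier => p.1 ∪ p.2) (lifts k R ×ˢ lifts k R')
      (lifts k (R ∪ R')) := by
  have hne : ∀ {T T' : Set W.carrier}, Set.MapsTo k T R → Set.MapsTo k T' R' →
      ∀ {x y}, x ∈ T → y ∈ T' → k x ≠ k y := fun h h' x y hx hy he =>
    Set.disjoint_left.1 hd (h hx) (he ▸ h' hy)
  refine ⟨?_, ?_, ?_⟩
  · rintro ⟨T, T'⟩ ⟨⟨hT, hTb⟩, ⟨hT', hTb'⟩⟩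
    refine ⟨hT.union hT', hTb.union hTb' ?_⟩
    rintro x (hx | hx) y (hy | hy) h
    · exact hTb.injOn hx hy h
    · exact (hne hTb.mapsTo hTb'.mapsTo hx hy h).elim
    · exact (hne hTb.mapsTo hTb'.mapsTo hy hx h.symm).elim
    · exact hTb'.injOn hx hy h
  · have hrec : ∀ T T' : Set W.carrier, Set.MapsTo k T R → Set.MapsTo k T' R' →
        T = (T ∪ T') ∩ k ⁻¹' R ∧ T' = (T ∪ T') ∩ k ⁻¹' R' := by
      intro T T' h h'
      constructor
      · ext x
        refine ⟨fun hx => ⟨Or.inl hx, h hx⟩, ?_⟩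
        rintro ⟨hx | hx, hxR⟩
        exacts [hx, (Set.disjoint_left.1 hd hxR (h' hx)).elim]
      · ext x
        refine ⟨fun hx => ⟨Or.inr hx, h' hx⟩, ?_⟩
        rintro ⟨hx | hx, hxR⟩
        exacts [(Set.disjoint_left.1 hd (h hx) hxR).elim, hx]
    rintro ⟨T, T'⟩ ⟨⟨hT, hTb⟩, ⟨hT', hTb'⟩⟩ ⟨V, V'⟩ ⟨⟨hV, hVb⟩, ⟨hV', hVb'⟩⟩ h
    have h1 := hrec T T' hTb.mapsTo hTb'.mapsTo
    have h2 := hrec V V' hVb.mapsTo hVb'.mapsTo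
    dsimp only at h
    refine Prod.ext ?_ ?_
    · show T = V
      rw [h1.1, h, ← h2.1]
    · show T' = V'
      rw [h1.2, h, ← h2.2]
  · rintro T ⟨hT, hTb⟩
    have hsub : ∀ R₀ : Set U.carrier, Inv R₀ → R₀ ⊆ R ∪ R' → T ∩ k ⁻¹' R₀ ∈ lifts k R₀ := by
      intro R₀ hR₀ hs
      refine ⟨hT.inter (hR₀.preimage k), fun x hx => hx.2,
        hTb.injOn.mono Set.inter_subset_left, ?_⟩
      intro y hy
      obtain ⟨x, hx, rfl⟩ := hTb.surjOn (hs hy)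
      exact ⟨x, ⟨hx, hy⟩, rfl⟩
    refine ⟨(T ∩ k ⁻¹' R, T ∩ k ⁻¹' R'), ⟨hsub R hR Set.subset_union_left,
      hsub R' hR' Set.subset_union_right⟩, ?_⟩
    show T ∩ k ⁻¹' R ∪ T ∩ k ⁻¹' R' = T
    rw [← Set.inter_union_distrib_left, ← Set.preimage_union]
    exact Set.inter_eq_left.2 hTb.mapsTo

/-- The product over orbits of a transfer, expanded by distributivity. -/
theorem prod_tr {W U : FinGSet G} (k : W.carrier →[G] U.carrier) (w : M.obj W)
    (R : Set U.carrier) (hR : Inv R) :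
    D.prod (M.tr k w) R = ∑ᶠ T ∈ lifts k R, D.prod w T := by
  refine inv_induction (p := fun R => D.prod (M.tr k w) R = ∑ᶠ T ∈ lifts k R, D.prod w T)
    ?_ ?_ R hR
  · rw [D.prod_empty, show lifts k ∅ = {∅} from ?_, finsum_mem_singleton, D.prod_empty]
    ext T
    constructor
    · rintro ⟨hT, hTb⟩
      exact Set.eq_empty_iff_forall_notMem.2 fun x hx => hTb.mapsTo hx
    · rintro rfl
      exact ⟨Inv.empty, Set.bijOn_empty _⟩
  · intro R x hR ih hd
    rw [D.prod_union _ hR hd, ih]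
    obtain ⟨i, f, hf, hr⟩ := D.exists_chart x
    rw [← hr] at hd ⊢
    rw [D.prod_tr_range k w f hf, finsum_mem_mul_finsum_mem]
    refine finsum_mem_eq_of_bijOn _ (lifts_union_bijOn k hR (Inv.range f) hd) ?_
    rintro ⟨T, T'⟩ ⟨⟨hT, hTb⟩, ⟨hT', hTb'⟩⟩
    refine (D.prod_union w hT ?_).symm
    rw [Set.disjoint_left]
    exact fun y hy hy' => Set.disjoint_left.1 hd (hTb.mapsTo hy) (hTb'.mapsTo hy')

end FixChar

/-- The set of fixed points of a finite `G`-set. -/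
def fixedPts (X : FinGSet G) : Set X.carrier := {v | ∀ g : G, g • v = v}

theorem map_mem_fixedPts {X Y : FinGSet G} (f : X.carrier →[G] Y.carrier) {v : X.carrier}
    (hv : v ∈ fixedPts X) : f v ∈ fixedPts Y := fun g => by
  rw [← MulActionHom.map_smul, hv g]

theorem Inv.fiber {X Y : FinGSet G} (f : X.carrier →[G] Y.carrier) {v : Y.carrier}
    (hv : v ∈ fixedPts Y) : Inv (f ⁻¹' {v}) := (Inv.singleton hv).preimage f

theorem fixedPts_sumG (X Y : FinGSet G) :
    fixedPts (sumG X Y) = inlHom X Y '' fixedPts X ∪ inrHom X Y '' fixedPts Y := by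
  ext x
  constructor
  · intro h
    rcases x with x | x
    · exact Or.inl ⟨x, fun g => Sum.inl_injective (h g), rfl⟩
    · exact Or.inr ⟨x, fun g => Sum.inr_injective (h g), rfl⟩
  · rintro (⟨x, hx, rfl⟩ | ⟨x, hx, rfl⟩)
    · exact map_mem_fixedPts _ hx
    · exact map_mem_fixedPts _ hx

theorem fixedPts_quotG {K : Subgroup G} (hK : K ≠ ⊤) : fixedPts (quotG G K) = ∅ := by
  rw [Set.eq_empty_iff_forall_notMem]
  intro x hx
  obtain ⟨a, rfl⟩ := exists_smul_bp x
  refine hK (eq_top_iff.2 fun g _ => ?_)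
  have h := hx (a * g * a⁻¹)
  rw [← mul_smul, inv_mul_cancel_right, smul_bp_eq_smul_bp] at h
  have h' := K.inv_mem h
  simpa using h'

/-- The point of `∗`. -/
def star (G : Type) [Group G] : (ptG G).carrier := PUnit.unit

theorem fixedPts_ptG : fixedPts (ptG G) = {star G} :=
  Set.ext fun _ => ⟨fun _ => rfl, fun _ _ => rfl⟩

theorem inlHom_injective (X Y : FinGSet G) : Function.Injective (inlHom X Y) := Sum.inl_injective

theorem inrHom_injective (X Y : FinGSet G) : Function.Injective (inrHom X Y) := Sum.inr_injective

/-- Fixed points of a dependent product correspond to invariant lifts. -/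
theorem bijOn_fixed_lifts {W U V A B : FinGSet G} {k : W.carrier →[G] U.carrier}
    {i : U.carrier →[G] V.carrier} {f : A.carrier →[G] W.carrier} {g : A.carrier →[G] B.carrier}
    {h : B.carrier →[G] V.carrier} (hd : IsDistributor k i f g h) {v : V.carrier}
    (hv : v ∈ fixedPts V) :
    (∀ b, Set.InjOn f (g ⁻¹' {b})) ∧
    Set.BijOn (fun b => f '' (g ⁻¹' {b})) {b | b ∈ fixedPts B ∧ h b = v}
      (lifts k (i ⁻¹' {v})) := by
  obtain ⟨α, β, hα, hβ, hf, hg, hh⟩ := hd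
  have hkf : ∀ a, k (f a) = (α a).1.1 := fun a => by
    rw [← hf]
    exact (α a).1.2.isSec _ _
  have hinj : ∀ a a', g a = g a' → k (f a) = k (f a') → a = a' := by
    intro a a' h1 h2
    rw [hkf, hkf] at h2
    refine α.injective (Subtype.ext (Prod.ext h2 ?_))
    rw [← hg, ← hg, h1]
  have hex : ∀ (b : B.carrier) (y : U.carrier) (hy : i y = (β b).pt),
      ∃ a, g a = b ∧ k (f a) = y ∧ f a = (β b).sec y hy := by
    intro b y hy
    obtain ⟨a, ha⟩ : ∃ a, α a = (⟨(y, β b), hy⟩ : ECan k i) := α.surjective _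
    exact ⟨a, β.injective (by rw [hg, ha]), by rw [hkf, ha], by rw [← hf, ha]; rfl⟩
  have hmaps : Set.MapsTo (fun b => f '' (g ⁻¹' {b})) {b | b ∈ fixedPts B ∧ h b = v}
      (lifts k (i ⁻¹' {v})) := by
    rintro b ⟨hb, hbv⟩
    refine ⟨(Inv.fiber g hb).image f, ?_, ?_, ?_⟩
    · rintro _ ⟨a, ha, rfl⟩
      show i (k (f a)) = v
      rw [hkf, (α a).2]
      show (α a).1.2.pt = v
      rw [← hg, hh, show g a = b from ha, hbv]
    · rintro _ ⟨a, ha, rfl⟩ _ ⟨a', ha', rfl⟩ he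
      rw [hinj a a' (Eq.trans ha (Eq.symm ha')) he]
    · intro y hy
      obtain ⟨a, h1, h2, -⟩ := hex b y (by rw [hh, hbv]; exact hy)
      exact ⟨f a, ⟨a, h1, rfl⟩, h2⟩
  refine ⟨fun b a ha a' ha' he => hinj a a' (Eq.trans ha (Eq.symm ha')) (congrArg k he),
    hmaps, ?_, ?_⟩
  · intro b hb b' hb' he
    dsimp only at he
    apply β.injective
    refine Sec.ext' (by rw [hh, hh, hb.2, hb'.2]) fun y hy hy' => ?_
    obtain ⟨a, h1, h2, h3⟩ := hex b y hy
    obtain ⟨a', h1', h2', h3'⟩ := hex b' y hy'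
    rw [← h3, ← h3']
    refine (hmaps hb).2.injOn ⟨a, h1, rfl⟩ ?_ (h2.trans h2'.symm)
    show f a' ∈ f '' (g ⁻¹' {b})
    rw [he]
    exact ⟨a', h1', rfl⟩
  · rintro T ⟨hT, hTb⟩
    have hs : ∀ y, i y = v → ∃ t, t ∈ T ∧ k t = y := fun y hy => hTb.surjOn hy
    choose s hsT hsk using hs
    let σ : Sec k i := ⟨v, s, hsk⟩
    have hfix : ∀ γ : G, γ • σ = σ := by
      intro γ
      refine Sec.ext' (hv γ) fun y hy hy' => ?_
      have hy'' : i (γ⁻¹ • y) = v := by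
        rw [MulActionHom.map_smul, show i y = v from hy']
        exact hv _
      rw [Sec.smul_sec γ σ y hy hy'']
      refine hTb.injOn (hT _ _ (hsT _ _)) (hsT _ _) ?_
      rw [MulActionHom.map_smul]
      show γ • k (s (γ⁻¹ • y) hy'') = k (s y hy')
      rw [hsk, hsk, smul_inv_smul]
    have hβσ : β (β.symm σ) = σ := β.apply_symm_apply σ
    refine ⟨β.symm σ, ⟨fun γ => ?_, ?_⟩, ?_⟩
    · apply β.injective
      rw [hβ, hβσ, hfix]
    · rw [← hh, hβσ]
    · have hev : ∀ q : ECan k i, q.1.2 = σ → eval k i q ∈ T := by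
        rintro ⟨⟨y, τ⟩, hq⟩ hτ
        dsimp only at hτ
        subst hτ
        exact hsT _ _
      ext t
      constructor
      · rintro ⟨a, ha, rfl⟩
        rw [← hf]
        apply hev
        rw [← hg, show g a = _ from ha, hβσ]
      · intro ht
        obtain ⟨a, h1, h2, -⟩ := hex (β.symm σ) (k t) (by rw [hβσ]; exact hTb.mapsTo ht)
        refine ⟨a, h1, hTb.injOn ?_ ht h2⟩
        rw [← hf]
        apply hev
        rw [← hg, h1, hβσ]

/-- The external sum of two pairs. -/
noncomputable def boxPre (M : SemiMackey G) {X Y : FinGSet G} (a : PreT M X) (b : PreT M Y) :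
    PreT M (sumG X Y) where
  U := sumG a.U b.U
  V := sumG a.V b.V
  i := sumMapHom a.i b.i
  j := sumMapHom a.j b.j
  u := M.pairElt a.u b.u

namespace FixChar

variable {M : Mackey G} {ι S : Type} [CommRing S] (D : FixChar M ι S)

/-- The value of the induced ring homomorphism on a pair. -/
noncomputable def ev (a : PreT M.toSemiMackey (ptG G)) : S :=
  ∑ᶠ v ∈ fixedPts a.V, D.prod a.u (a.i ⁻¹' {v})

theorem ev_iso {a b : PreT M.toSemiMackey (ptG G)} (h : IsoRel M.toSemiMackey (ptG G) a b) :
    D.ev a = D.ev b := by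
  obtain ⟨f, g, hf, hg, hi, hj, hu⟩ := h
  symm
  have hgfix : ∀ v, v ∈ fixedPts b.V ↔ g v ∈ fixedPts a.V := fun v =>
    ⟨fun h γ => by rw [← hg, h γ], fun h γ => g.injective (by rw [hg, h γ])⟩
  refine finsum_mem_eq_of_bijOn g ⟨fun v hv => (hgfix v).1 hv, g.injective.injOn, fun v hv =>
    ⟨g.symm v, (hgfix _).2 (by rwa [g.apply_symm_apply]), g.apply_symm_apply v⟩⟩ ?_
  intro v hv
  rw [← hu]
  refine D.prod_res_bijOn _ _ (Inv.fiber b.i hv) ⟨?_, f.injective.injOn, ?_⟩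
  · rintro u rfl
    exact hi u
  · intro u hu
    refine ⟨f.symm u, g.injective ?_, f.apply_symm_apply u⟩
    rw [← hi, f.apply_symm_apply]
    exact hu

theorem ev_distrib {W U V A B : FinGSet G} (k : W.carrier →[G] U.carrier)
    (i : U.carrier →[G] V.carrier) (j : V.carrier →[G] (ptG G).carrier)
    (f : A.carrier →[G] W.carrier) (g : A.carrier →[G] B.carrier)
    (h : B.carrier →[G] V.carrier) (hd : IsDistributor k i f g h) (w : M.obj W) :
    D.ev ⟨U, V, i, j, M.tr k w⟩ = D.ev ⟨A, B, g, gcomp j h, M.res f w⟩ := by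
  show ∑ᶠ v ∈ fixedPts V, D.prod (M.tr k w) (i ⁻¹' {v}) =
    ∑ᶠ b ∈ fixedPts B, D.prod (M.res f w) (g ⁻¹' {b})
  have hB : fixedPts B = ⋃ v ∈ fixedPts V, {b | b ∈ fixedPts B ∧ h b = v} := by
    ext b
    simp only [Set.mem_iUnion]
    exact ⟨fun hb => ⟨h b, map_mem_fixedPts h hb, hb, rfl⟩, fun ⟨_, _, hb, _⟩ => hb⟩
  rw [hB, finsum_mem_biUnion _ (Set.toFinite _) fun _ _ => Set.toFinite _]
  · refine finsum_mem_congr rfl fun v hv => ?_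
    obtain ⟨hinj, hbij⟩ := bijOn_fixed_lifts hd hv
    rw [D.prod_tr k w _ (Inv.fiber i hv)]
    symm
    exact finsum_mem_eq_of_bijOn _ hbij fun b hb =>
      D.prod_res_image f w _ (Inv.fiber g hb.1) (hinj b)
  · intro v _ v' _ hne
    rw [Function.onFun, Set.disjoint_left]
    rintro b ⟨-, rfl⟩ ⟨-, h'⟩
    exact hne h'

theorem ev_rel {a b : PreT M.toSemiMackey (ptG G)} (h : STRel M.toSemiMackey (ptG G) a b) :
    D.ev a = D.ev b := by
  cases h with
  | iso h => exact D.ev_iso h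
  | distrib k i j f g h hd w => exact D.ev_distrib k i j f g h hd w

theorem ev_quot {a b : PreT M.toSemiMackey (ptG G)}
    (h : Quot.mk (STRel M.toSemiMackey (ptG G)) a = Quot.mk (STRel M.toSemiMackey (ptG G)) b) :
    D.ev a = D.ev b :=
  congrArg (Quot.lift D.ev fun _ _ h => D.ev_rel h) h

theorem prod_sum_inl {X Y : FinGSet G} (u : M.obj X) (u' : M.obj Y) {R : Set X.carrier}
    (hR : Inv R) : D.prod (M.toSemiMackey.pairElt u u') (inlHom X Y '' R) = D.prod u R := by
  rw [← D.prod_res_image (inlHom X Y) _ R hR Sum.inl_injective.injOn,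
    M.toSemiMackey.res_inl_pairElt]

theorem prod_sum_inr {X Y : FinGSet G} (u : M.obj X) (u' : M.obj Y) {R : Set Y.carrier}
    (hR : Inv R) : D.prod (M.toSemiMackey.pairElt u u') (inrHom X Y '' R) = D.prod u' R := by
  rw [← D.prod_res_image (inrHom X Y) _ R hR Sum.inr_injective.injOn,
    M.toSemiMackey.res_inr_pairElt]

theorem ev_add (a b : PreT M.toSemiMackey (ptG G)) :
    D.ev (addPre M.toSemiMackey a b) = D.ev a + D.ev b := by
  show ∑ᶠ v ∈ fixedPts (sumG a.V b.V), D.prod (M.toSemiMackey.pairElt a.u b.u)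
    (sumMapHom a.i b.i ⁻¹' {v}) = _
  rw [fixedPts_sumG, finsum_mem_union _ (Set.toFinite _) (Set.toFinite _),
    finsum_mem_image (inlHom_injective _ _).injOn, finsum_mem_image (inrHom_injective _ _).injOn]
  · refine congrArg₂ (· + ·) (finsum_mem_congr rfl fun v hv => ?_)
      (finsum_mem_congr rfl fun v hv => ?_)
    · rw [← D.prod_sum_inl a.u b.u (Inv.fiber a.i hv)]
      congr 1
      ext (u | u)
      · exact ⟨fun h => ⟨u, Sum.inl_injective h, rfl⟩, fun ⟨u', h, h'⟩ => by
          cases h'; exact congrArg Sum.inl h⟩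
      · exact ⟨fun h => (Sum.inr_ne_inl h).elim, fun ⟨u', _, h'⟩ => (Sum.inl_ne_inr h').elim⟩
    · rw [← D.prod_sum_inr a.u b.u (Inv.fiber b.i hv)]
      congr 1
      ext (u | u)
      · exact ⟨fun h => (Sum.inl_ne_inr h).elim, fun ⟨u', _, h'⟩ => (Sum.inr_ne_inl h').elim⟩
      · exact ⟨fun h => ⟨u, Sum.inr_injective h, rfl⟩, fun ⟨u', h, h'⟩ => by
          cases h'; exact congrArg Sum.inr h⟩
  · rw [Set.disjoint_left]
    rintro _ ⟨x, _, rfl⟩ ⟨y, _, h⟩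
    exact Sum.inr_ne_inl h

theorem ev_tr {K : Subgroup G} (hK : K ≠ ⊤) (a : PreT M.toSemiMackey (quotG G K)) :
    D.ev (trPre M.toSemiMackey (toPtHom (quotG G K)) a) = 0 := by
  have : fixedPts a.V = ∅ := by
    rw [Set.eq_empty_iff_forall_notMem]
    intro v hv
    have := map_mem_fixedPts a.j hv
    rw [fixedPts_quotG hK] at this
    exact this
  show ∑ᶠ v ∈ fixedPts a.V, D.prod a.u (a.i ⁻¹' {v}) = 0
  rw [this, finsum_mem_empty]

theorem ev_Xi (i : ι) (x : M.obj (quotG G (D.H i))) : D.ev (XiPre M (D.H i) x) = D.ψ i x := by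
  show ∑ᶠ v ∈ fixedPts (ptG G), D.prod x (toPtHom (quotG G (D.H i)) ⁻¹' {v}) = _
  have h2 : (toPtHom (quotG G (D.H i))) ⁻¹' {star G} =
      Set.range (gid G (quotG G (D.H i)).carrier) :=
    Set.ext fun v => ⟨fun _ => ⟨v, rfl⟩, fun _ => rfl⟩
  rw [fixedPts_ptG, finsum_mem_singleton, h2, D.prod_range x _ fun _ _ h => h]
  exact congrArg (D.ψ i) (M.res_id x)

theorem ev_one (a : PreT M.toSemiMackey (emptyG G)) :
    D.ev (normPre M.toSemiMackey (initHom (ptG G)) a) = 1 := by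
  obtain ⟨σ, hσ⟩ : ∃ σ : (normPre M.toSemiMackey (initHom (ptG G)) a).V.carrier, ∀ τ, τ = σ :=
    ⟨(⟨PUnit.unit, fun y => y.elim, fun y => y.elim⟩ : Sec a.j (initHom (ptG G))),
      fun τ => Sec.ext' rfl fun y => y.elim⟩
  have h1 : fixedPts (normPre M.toSemiMackey (initHom (ptG G)) a).V = {σ} :=
    Set.ext fun v => ⟨fun _ => hσ v, fun _ _ => (hσ _).trans (hσ _).symm⟩
  rw [ev, h1, finsum_mem_singleton]
  refine (congrArg _ (Set.eq_empty_iff_forall_notMem.2 ?_)).trans (D.prod_empty _)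
  intro p
  exact (show Empty from p.1.2.1.1).elim

/-- The section of a pair of maps to the point determined by a pair of points. -/
def pairSec {V V' : FinGSet G} (j : V.carrier →[G] (ptG G).carrier)
    (j' : V'.carrier →[G] (ptG G).carrier) (p : V.carrier × V'.carrier) :
    Sec (sumMapHom j j') (foldHom (ptG G)) where
  pt := PUnit.unit
  sec := fun y _ => Sum.elim (fun _ => Sum.inl p.1) (fun _ => Sum.inr p.2) y
  isSec := by rintro (y | y) _ <;> rfl

theorem pairSec_bijOn {V V' : FinGSet G} (j : V.carrier →[G] (ptG G).carrier)
    (j' : V'.carrier →[G] (ptG G).carrier) :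
    Set.BijOn (pairSec j j') (fixedPts V ×ˢ fixedPts V')
      (fixedPts (mkG G (Sec (sumMapHom j j') (foldHom (ptG G))))) := by
  have hsec : ∀ (γ : G) (p : V.carrier × V'.carrier),
      γ • pairSec j j' p = pairSec j j' (γ • p) := fun γ p =>
    Sec.ext' rfl (by rintro (y | y) _ _ <;> rfl)
  have hinj : Function.Injective (pairSec j j') := by
    intro p p' h
    have key : ∀ (σ τ : Sec (sumMapHom j j') (foldHom (ptG G))), σ = τ →
        ∀ y, σ.sec y rfl = τ.sec y rfl := by
      rintro σ _ rfl y
      rfl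
    exact Prod.ext (Sum.inl_injective (key _ _ h (Sum.inl PUnit.unit)))
      (Sum.inr_injective (key _ _ h (Sum.inr PUnit.unit)))
  refine ⟨?_, hinj.injOn, ?_⟩
  · rintro p ⟨hp, hp'⟩ γ
    refine (hsec γ p).trans (congrArg _ (Prod.ext (hp γ) (hp' γ)))
  · intro σ hσ
    obtain ⟨p, rfl⟩ : ∃ p, pairSec j j' p = σ := by
      have h1 := σ.isSec (Sum.inl PUnit.unit) rfl
      have h2 := σ.isSec (Sum.inr PUnit.unit) rfl
      rcases e1 : σ.sec (Sum.inl PUnit.unit) rfl with v | v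
      · rcases e2 : σ.sec (Sum.inr PUnit.unit) rfl with w | w
        · rw [e2] at h2
          exact (Sum.inl_ne_inr h2).elim
        · refine ⟨(v, w), Sec.ext' rfl ?_⟩
          rintro (y | y) _ _
          · exact e1.symm
          · exact e2.symm
      · rw [e1] at h1
        exact (Sum.inr_ne_inl h1).elim
    refine ⟨p, ⟨fun γ => ?_, fun γ => ?_⟩, rfl⟩
    · exact congrArg Prod.fst (hinj ((hsec γ p).symm.trans (hσ γ)))
    · exact congrArg Prod.snd (hinj ((hsec γ p).symm.trans (hσ γ)))

theorem ev_mul (a b : PreT M.toSemiMackey (ptG G)) :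
    D.ev (normPre M.toSemiMackey (foldHom (ptG G)) (boxPre M.toSemiMackey a b)) =
      D.ev a * D.ev b := by
  rw [ev, ev, ev, finsum_mem_mul_finsum_mem]
  symm
  refine finsum_mem_eq_of_bijOn _ (pairSec_bijOn a.j b.j) ?_
  rintro ⟨v, v'⟩ ⟨hv, hv'⟩
  dsimp only at hv hv' ⊢
  rw [← D.prod_sum_inl a.u b.u (Inv.fiber a.i hv), ← D.prod_sum_inr a.u b.u (Inv.fiber b.i hv'),
    ← D.prod_union _ ((Inv.fiber a.i hv).image _)]
  · symm
    refine D.prod_res_bijOn (pfst (Y := mkG G (ECan (sumMapHom a.j b.j) (foldHom (ptG G))))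
      (sumMapHom a.i b.i)
      (evalHom _ _)) _
      (Inv.fiber _ ((pairSec_bijOn a.j b.j).mapsTo (show (v, v') ∈ _ from ⟨hv, hv'⟩))) ⟨?_, ?_, ?_⟩
    · rintro ⟨⟨u, ⟨⟨y, τ⟩, hy⟩⟩, hu⟩ hp
      have hτ : τ = pairSec a.j b.j (v, v') := hp
      subst hτ
      rcases y with y | y <;> rcases u with u | u
      · exact Or.inl ⟨u, Sum.inl_injective hu, rfl⟩
      · exact (Sum.inr_ne_inl hu).elim
      · exact (Sum.inl_ne_inr hu).elim
      · exact Or.inr ⟨u, Sum.inr_injective hu, rfl⟩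
    · rintro ⟨⟨u, ⟨⟨y, τ⟩, hy⟩⟩, hu⟩ hp ⟨⟨u', ⟨⟨y', τ'⟩, hy'⟩⟩, hu'⟩ hp' h
      have hτ : τ = pairSec a.j b.j (v, v') := hp
      have hτ' : τ' = pairSec a.j b.j (v, v') := hp'
      have hu0 : u = u' := h
      subst hτ hτ' hu0
      have hyy : y = y' := by
        rcases y with y | y <;> rcases y' with y' | y'
        · rfl
        · exact (Sum.inl_ne_inr (Eq.trans (Eq.symm hu) hu')).elim
        · exact (Sum.inr_ne_inl (Eq.trans (Eq.symm hu) hu')).elim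
        · rfl
      subst hyy
      rfl
    · rintro _ (⟨u, hu, rfl⟩ | ⟨u, hu, rfl⟩)
      · exact ⟨⟨(Sum.inl u, ⟨(Sum.inl PUnit.unit, pairSec a.j b.j (v, v')), rfl⟩),
          congrArg Sum.inl hu⟩, rfl, rfl⟩
      · exact ⟨⟨(Sum.inr u, ⟨(Sum.inr PUnit.unit, pairSec a.j b.j (v, v')), rfl⟩),
          congrArg Sum.inr hu⟩, rfl, rfl⟩
  · rw [Set.disjoint_left]
    rintro _ ⟨x, _, rfl⟩ ⟨y, _, h⟩
    exact Sum.inr_ne_inl h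

end FixChar

/-- The additive group structure on the values of a Tambara functor. -/
@[reducible] noncomputable def Tambara.addCommGroup (T : Tambara G) (X : FinGSet G) :
    AddCommGroup (T.obj X) :=
  let := T.toSemiMackey.addCommMonoid X
  letI : Neg (T.obj X) := ⟨fun x => (T.hasNeg X x).choose⟩
  { T.toSemiMackey.addCommMonoid X with
    neg_add_cancel := fun x =>
      (T.toSemiMackey.add_comm' _ _).trans (T.hasNeg X x).choose_spec
    zsmul := zsmulRec }

namespace SemiTambara

variable (R : SemiTambara G)

/-- The norms of a semi-Tambara functor form the transfers of a semi-Mackey functor. -/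
def mulMackey : SemiMackey G where
  obj := R.obj
  nonempty := R.nonempty
  res := R.res
  tr := R.nm
  res_id := R.res_id
  res_comp := R.res_comp
  tr_id := R.nm_id
  tr_comp := R.nm_comp
  mackey := R.nm_res
  sum_bij := R.sum_bij
  empty_subsingleton := R.empty_subsingleton

theorem mul_comm' {X : FinGSet G} (x y : R.obj X) : R.mul x y = R.mul y x :=
  R.mulMackey.add_comm' x y

theorem res_mul {X Y : FinGSet G} (f : X.carrier →[G] Y.carrier) (x y : R.obj Y) :
    R.res f (R.mul x y) = R.mul (R.res f x) (R.res f y) :=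
  R.mulMackey.res_add f x y

/-- The section of `fold ⊔ id` determined by a point of `X ⊔ X`. -/
def foldSec (X : FinGSet G) (b : (sumG X X).carrier) :
    Sec (sumMapHom (foldHom X) (gid G X.carrier)) (foldHom X) where
  pt := foldHom X b
  sec := fun y _ => Sum.elim (fun _ => Sum.inl b) Sum.inr y
  isSec := by
    rintro (y | y) h
    · exact congrArg Sum.inl h.symm
    · rfl

theorem isDistributor_fold (X : FinGSet G) :
    IsDistributor (sumMapHom (foldHom X) (gid G X.carrier)) (foldHom X)
      (sumMapHom (gid G (sumG X X).carrier) (foldHom X)) (foldHom (sumG X X)) (foldHom X) := by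
  have hβ : Function.Bijective (foldSec X) := by
    constructor
    · intro b b' h
      have key : ∀ σ τ : Sec (sumMapHom (foldHom X) (gid G X.carrier)) (foldHom X), σ = τ →
          ∀ y hy hy', σ.sec y hy = τ.sec y hy' := by
        rintro σ _ rfl y _ _
        rfl
      have h1 : foldHom X b = foldHom X b' := congrArg Sec.pt h
      exact Sum.inl_injective (key _ _ h (Sum.inl (foldHom X b)) rfl h1)
    · intro σ
      rcases e : σ.sec (Sum.inl σ.pt) rfl with b | b
      · have h1 := σ.isSec (Sum.inl σ.pt) rfl
        rw [e] at h1
        refine ⟨b, Sec.ext' (Sum.inl_injective h1) ?_⟩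
        rintro (y | y) h h'
        · have hy : y = σ.pt := h'
          subst hy
          exact e.symm
        · have h2 := σ.isSec (Sum.inr y) h'
          rcases e' : σ.sec (Sum.inr y) h' with z | z
          · rw [e'] at h2
            exact (Sum.inl_ne_inr h2).elim
          · rw [e'] at h2
            exact congrArg Sum.inr (Sum.inr_injective h2).symm
      · have h1 := σ.isSec (Sum.inl σ.pt) rfl
        rw [e] at h1
        exact (Sum.inr_ne_inl h1).elim
  let A : (sumG (sumG X X) (sumG X X)).carrier →
      ECan (sumMapHom (foldHom X) (gid G X.carrier)) (foldHom X) :=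
    Sum.elim (fun b => ⟨(Sum.inl (foldHom X b), foldSec X b), rfl⟩)
      (fun b => ⟨(Sum.inr (foldHom X b), foldSec X b), rfl⟩)
  have hA2 : ∀ a, (A a).1.2 = foldSec X (foldHom (sumG X X) a) := by rintro (a | a) <;> rfl
  have hA : Function.Bijective A := by
    constructor
    · intro a a' h
      have h1 : (A a).1.1 = (A a').1.1 := congrArg (fun q => q.1.1) h
      have h2 : (A a).1.2 = (A a').1.2 := congrArg (fun q => q.1.2) h
      rw [hA2, hA2] at h2
      have h3 := hβ.1 h2
      rcases a with a | a <;> rcases a' with a' | a'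
      · exact congrArg Sum.inl h3
      · exact (Sum.inl_ne_inr h1).elim
      · exact (Sum.inr_ne_inl h1).elim
      · exact congrArg Sum.inr h3
    · rintro ⟨⟨y, σ⟩, h⟩
      obtain ⟨b, rfl⟩ := hβ.2 σ
      rcases y with y | y
      · have hy : y = foldHom X b := h
        subst hy
        exact ⟨Sum.inl b, rfl⟩
      · have hy : y = foldHom X b := h
        subst hy
        exact ⟨Sum.inr b, rfl⟩
  have hβG : ∀ (g : G) b, foldSec X (g • b) = g • foldSec X b := fun g b =>
    Sec.ext' (MulActionHom.map_smul _ _ _) (by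
      rintro (y | y) _ _
      · rfl
      · exact congrArg Sum.inr (smul_inv_smul g y).symm)
  refine ⟨Equiv.ofBijective A hA, Equiv.ofBijective _ hβ, ?_, hβG, ?_, ?_, fun _ => rfl⟩
  · rintro g (b | b)
    · exact Subtype.ext (Prod.ext (congrArg Sum.inl (MulActionHom.map_smul _ _ _)) (hβG g b))
    · exact Subtype.ext (Prod.ext (congrArg Sum.inr (MulActionHom.map_smul _ _ _)) (hβG g b))
  · rintro (b | b) <;> rfl
  · intro a
    exact (hA2 a).symm

theorem add_mul' {X : FinGSet G} (x y z : R.obj X) :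
    R.mul (R.add x y) z = R.add (R.mul x z) (R.mul y z) := by
  have h := R.distrib _ _ _ _ _ (isDistributor_fold X) (R.pairElt (R.pairElt x y) z)
  rw [R.tr_sumMap, R.res_sumMap, R.tr_id, R.res_id] at h
  refine h.trans ?_
  refine congrArg (R.tr (foldHom X)) (R.sum_ext ?_ ?_)
  · rw [R.res_inl_pairElt]
    refine (R.res_mul _ _ _).trans ?_
    rw [R.res_inl_pairElt, R.res_comp_apply _ _ (gid G X.carrier) fun _ => rfl, R.res_id]
  · rw [R.res_inr_pairElt]
    refine (R.res_mul _ _ _).trans ?_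
    rw [R.res_inr_pairElt, R.res_comp_apply _ _ (gid G X.carrier) fun _ => rfl, R.res_id]

theorem mul_add' {X : FinGSet G} (x y z : R.obj X) :
    R.mul x (R.add y z) = R.add (R.mul x y) (R.mul x z) := by
  rw [R.mul_comm', R.add_mul', R.mul_comm' y, R.mul_comm' z]

end SemiTambara

theorem isoRel_of_hom {M : SemiMackey G} {X : FinGSet G} {a b : PreT M X}
    (f : b.U.carrier →[G] a.U.carrier) (g : b.V.carrier →[G] a.V.carrier)
    (hf : Function.Bijective f) (hg : Function.Bijective g)
    (hi : ∀ u, a.i (f u) = g (b.i u)) (hj : ∀ v, a.j (g v) = b.j v)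
    (hu : M.res f a.u = b.u) : IsoRel M X a b :=
  ⟨Equiv.ofBijective f hf, Equiv.ofBijective g hg, fun γ u => MulActionHom.map_smul f γ u,
    fun γ v => MulActionHom.map_smul g γ v, hi, hj, hu⟩

/-- A Tambara functor `T` presented as the levelwise additive completion of `sT(M)`. -/
structure Presentation (M : Mackey G) where
  T : Tambara G
  c : ∀ X : FinGSet G, PreT M.toSemiMackey X → T.obj X
  rel : ∀ (X : FinGSet G) (a b : PreT M.toSemiMackey X),
    Quot.mk (STRel M.toSemiMackey X) a = Quot.mk (STRel M.toSemiMackey X) b → c X a = c X b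
  map_tr : ∀ {X Y : FinGSet G} (f : X.carrier →[G] Y.carrier) (a : PreT M.toSemiMackey X),
    c Y (trPre M.toSemiMackey f a) = T.tr f (c X a)
  map_res : ∀ {X Y : FinGSet G} (f : Y.carrier →[G] X.carrier) (a : PreT M.toSemiMackey X),
    c Y (resPre M.toSemiMackey f a) = T.res f (c X a)
  map_nm : ∀ {X Y : FinGSet G} (f : X.carrier →[G] Y.carrier) (a : PreT M.toSemiMackey X),
    c Y (normPre M.toSemiMackey f a) = T.nm f (c X a)
  map_add : ∀ (X : FinGSet G) (a b : PreT M.toSemiMackey X),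
    c X (addPre M.toSemiMackey a b) = T.toSemiMackey.add (c X a) (c X b)
  sur : ∀ (X : FinGSet G) (t : T.obj X), ∃ a b : PreT M.toSemiMackey X,
    T.toSemiMackey.add t (c X b) = c X a
  inj : ∀ (X : FinGSet G) (a b : PreT M.toSemiMackey X),
    c X a = c X b ↔ ∃ k : PreT M.toSemiMackey X,
      Quot.mk (STRel M.toSemiMackey X) (addPre M.toSemiMackey a k) =
        Quot.mk (STRel M.toSemiMackey X) (addPre M.toSemiMackey b k)

namespace Presentation

variable {M : Mackey G} (P : Presentation M)

theorem c_iso {X : FinGSet G} {a b : PreT M.toSemiMackey X}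
    (f : b.U.carrier →[G] a.U.carrier) (g : b.V.carrier →[G] a.V.carrier)
    (hf : Function.Bijective f) (hg : Function.Bijective g)
    (hi : ∀ u, a.i (f u) = g (b.i u)) (hj : ∀ v, a.j (g v) = b.j v)
    (hu : M.res f a.u = b.u) : P.c X a = P.c X b :=
  P.rel _ _ _ (Quot.sound (STRel.iso (isoRel_of_hom f g hf hg hi hj hu)))

theorem c_boxPre {X Y : FinGSet G} (a : PreT M.toSemiMackey X) (b : PreT M.toSemiMackey Y) :
    P.c _ (boxPre M.toSemiMackey a b) = P.T.pairElt (P.c X a) (P.c Y b) := by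
  apply P.T.sum_ext
  · rw [P.T.res_inl_pairElt, ← P.map_res]
    let g : a.V.carrier →[G] (resPre M.toSemiMackey (inlHom X Y)
        (boxPre M.toSemiMackey a b)).V.carrier :=
      ⟨fun v => ⟨(Sum.inl v, a.j v), rfl⟩, fun γ v => Subtype.ext
        (Prod.ext rfl (MulActionHom.map_smul a.j γ v))⟩
    let f : a.U.carrier →[G] (resPre M.toSemiMackey (inlHom X Y)
        (boxPre M.toSemiMackey a b)).U.carrier :=
      ⟨fun u => ⟨(Sum.inl u, g (a.i u)), rfl⟩, fun γ u => Subtype.ext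
        (Prod.ext rfl (by
          show g (a.i (γ • u)) = γ • g (a.i u)
          rw [MulActionHom.map_smul, MulActionHom.map_smul]))⟩
    refine P.c_iso f g ⟨fun u u' h => ?_, ?_⟩ ⟨fun v v' h => ?_, ?_⟩ (fun _ => rfl)
      (fun _ => rfl) ?_
    · exact Sum.inl_injective (congrArg (fun q => q.1.1) h)
    · rintro ⟨⟨u | u, ⟨⟨v | v, x⟩, hv⟩⟩, hu⟩
      · have h1 : a.i u = v := Sum.inl_injective hu
        have h2 : a.j v = x := Sum.inl_injective hv
        subst h1 h2
        exact ⟨u, rfl⟩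
      · exact (Sum.inl_ne_inr hu).elim
      · exact (Sum.inr_ne_inl hu).elim
      · exact (Sum.inr_ne_inl hv).elim
    · exact Sum.inl_injective (congrArg (fun q => q.1.1) h)
    · rintro ⟨⟨v | v, x⟩, hv⟩
      · have h2 : a.j v = x := Sum.inl_injective hv
        subst h2
        exact ⟨v, rfl⟩
      · exact (Sum.inr_ne_inl hv).elim
    · exact (M.res_comp _ _ _).trans (M.res_inl_pairElt a.u b.u)
  · rw [P.T.res_inr_pairElt, ← P.map_res]
    let g : b.V.carrier →[G] (resPre M.toSemiMackey (inrHom X Y)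
        (boxPre M.toSemiMackey a b)).V.carrier :=
      ⟨fun v => ⟨(Sum.inr v, b.j v), rfl⟩, fun γ v => Subtype.ext
        (Prod.ext rfl (MulActionHom.map_smul b.j γ v))⟩
    let f : b.U.carrier →[G] (resPre M.toSemiMackey (inrHom X Y)
        (boxPre M.toSemiMackey a b)).U.carrier :=
      ⟨fun u => ⟨(Sum.inr u, g (b.i u)), rfl⟩, fun γ u => Subtype.ext
        (Prod.ext rfl (by
          show g (b.i (γ • u)) = γ • g (b.i u)
          rw [MulActionHom.map_smul, MulActionHom.map_smul]))⟩
    refine P.c_iso f g ⟨fun u u' h => ?_, ?_⟩ ⟨fun v v' h => ?_, ?_⟩ (fun _ => rfl)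
      (fun _ => rfl) ?_
    · exact Sum.inr_injective (congrArg (fun q => q.1.1) h)
    · rintro ⟨⟨u | u, ⟨⟨v | v, x⟩, hv⟩⟩, hu⟩
      · exact (Sum.inl_ne_inr hv).elim
      · exact (Sum.inl_ne_inr hu).elim
      · exact (Sum.inr_ne_inl hu).elim
      · have h1 : b.i u = v := Sum.inr_injective hu
        have h2 : b.j v = x := Sum.inr_injective hv
        subst h1 h2
        exact ⟨u, rfl⟩
    · exact Sum.inr_injective (congrArg (fun q => q.1.1) h)
    · rintro ⟨⟨v | v, x⟩, hv⟩
      · exact (Sum.inl_ne_inr hv).elim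
      · have h2 : b.j v = x := Sum.inr_injective hv
        subst h2
        exact ⟨v, rfl⟩
    · exact (M.res_comp _ _ _).trans (M.res_inr_pairElt a.u b.u)

theorem c_mul {X : FinGSet G} (a b : PreT M.toSemiMackey X) :
    P.c X (normPre M.toSemiMackey (foldHom X) (boxPre M.toSemiMackey a b)) =
      P.T.mul (P.c X a) (P.c X b) := by
  rw [P.map_nm, P.c_boxPre]
  rfl

theorem c_one {X : FinGSet G} (a : PreT M.toSemiMackey (emptyG G)) :
    P.c X (normPre M.toSemiMackey (initHom X) a) = P.T.one X := by
  rw [P.map_nm]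
  exact congrArg _ (P.T.empty_eq _ _)

/-- The empty pair. -/
noncomputable def emptyPre (M : SemiMackey G) (X : FinGSet G) : PreT M X :=
  ⟨emptyG G, emptyG G, gid G _, initHom X, (M.nonempty (emptyG G)).some⟩

variable {ι S : Type} [CommRing S] (D : FixChar M ι S)

/-- The ring homomorphism on `T(G/G)` induced by a family of characters. -/
noncomputable def ext (t : P.T.obj (ptG G)) : S :=
  D.ev (P.sur _ t).choose - D.ev (P.sur _ t).choose_spec.choose

theorem ext_eq {t : P.T.obj (ptG G)} {a b : PreT M.toSemiMackey (ptG G)}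
    (h : P.T.add t (P.c _ b) = P.c _ a) : P.ext D t = D.ev a - D.ev b := by
  let := P.T.addCommGroup (ptG G)
  have h' := (P.sur _ t).choose_spec.choose_spec
  rw [ext]
  set a' := (P.sur _ t).choose
  set b' := (P.sur _ t).choose_spec.choose
  have h1 : t + P.c _ b = P.c _ a := h
  have h2 : t + P.c _ b' = P.c _ a' := h'
  have h3 : P.c _ (addPre _ a b') = P.c _ (addPre _ a' b) := by
    rw [P.map_add, P.map_add, ← h, ← h']
    exact add_right_comm t (P.c _ b) (P.c _ b')
  obtain ⟨k, hk⟩ := (P.inj _ _ _).1 h3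
  have h4 := D.ev_quot hk
  rw [D.ev_add, D.ev_add, D.ev_add, D.ev_add] at h4
  linear_combination -h4

theorem ext_c (a : PreT M.toSemiMackey (ptG G)) : P.ext D (P.c _ a) = D.ev a := by
  rw [P.ext_eq D (P.map_add _ a a).symm, D.ev_add, add_sub_cancel_right]

theorem ext_add (x y : P.T.obj (ptG G)) : P.ext D (P.T.add x y) = P.ext D x + P.ext D y := by
  let := P.T.addCommGroup (ptG G)
  obtain ⟨a, b, h⟩ := P.sur _ x
  obtain ⟨a', b', h'⟩ := P.sur _ y
  have h3 : P.T.add (P.T.add x y) (P.c _ (addPre _ b b')) = P.c _ (addPre _ a a') := by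
    rw [P.map_add, P.map_add, ← h, ← h']
    exact add_add_add_comm x y _ _
  rw [P.ext_eq D h, P.ext_eq D h', P.ext_eq D h3, D.ev_add, D.ev_add]
  ring

theorem ext_trans {t : P.T.obj (ptG G)} (h : TransSetT P.T t) : P.ext D t = 0 := by
  induction h with
  | zero =>
    have := P.ext_add D (P.T.zero _) (P.T.zero _)
    rw [P.T.zero_add'] at this
    simpa using this
  | tr K hK y =>
    obtain ⟨a, b, h⟩ := P.sur _ y
    have h1 : P.T.add (P.T.tr (toPtHom (quotG G K)) y)
        (P.c _ (trPre _ (toPtHom (quotG G K)) b)) =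
        P.c _ (trPre _ (toPtHom (quotG G K)) a) := by
      rw [P.map_tr, P.map_tr, ← h, P.T.tr_add]
    rw [P.ext_eq D h1, D.ev_tr hK, D.ev_tr hK, sub_zero]
  | add _ _ ih ih' => rw [P.ext_add, ih, ih', add_zero]

theorem ext_rel {x y : P.T.obj (ptG G)} (h : relPhiT P.T x y) : P.ext D x = P.ext D y := by
  obtain ⟨s, t, hs, ht, h⟩ := h
  have := congrArg (P.ext D) h
  rwa [P.ext_add, P.ext_add, P.ext_trans D hs, P.ext_trans D ht, add_zero, add_zero] at this

theorem ext_mul (x y : P.T.obj (ptG G)) : P.ext D (P.T.mul x y) = P.ext D x * P.ext D y := by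
  obtain ⟨a, b, h⟩ := P.sur _ x
  obtain ⟨a', b', h'⟩ := P.sur _ y
  have hc : ∀ p q : PreT M.toSemiMackey (ptG G),
      P.ext D (P.T.mul (P.c _ p) (P.c _ q)) = D.ev p * D.ev q := fun p q => by
    rw [← P.c_mul, ext_c, D.ev_mul]
  have h1 := congrArg (fun z => P.ext D (P.T.mul x z)) h'
  have h2 := congrArg (fun z => P.ext D (P.T.mul z (P.c _ b'))) h
  have h3 := congrArg (fun z => P.ext D (P.T.mul z (P.c _ a'))) h
  rw [P.T.mul_add', P.ext_add] at h1
  rw [P.T.add_mul', P.ext_add, hc, hc] at h2 h3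
  rw [P.ext_eq D h, P.ext_eq D h']
  linear_combination h1 - h2 + h3

theorem ext_one : P.ext D (P.T.one (ptG G)) = 1 := by
  rw [← P.c_one (emptyPre _ _), ext_c, D.ev_one]

theorem ext_Xi (i : ι) (x : M.obj (quotG G (D.H i))) :
    P.ext D (P.c _ (XiPre M (D.H i) x)) = D.ψ i x := by
  rw [ext_c, D.ev_Xi]

end Presentation

/-- The pair `(U → ∗ → ∗, u)`. -/
def ptPre (M : SemiMackey G) (U : FinGSet G) (u : M.obj U) : PreT M (ptG G) :=
  ⟨U, ptG G, toPtHom U, gid G (ptG G).carrier, u⟩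

/-- The part of a pair lying over an invariant subset of its middle `G`-set. -/
def restrPre {M : SemiMackey G} {X : FinGSet G} (a : PreT M X) (S : Set a.V.carrier)
    (hS : Inv S) : PreT M X :=
  ⟨subG (a.i ⁻¹' S) (hS.preimage a.i), subG S hS,
    codHom S hS (gcomp a.i (inclHom _ (hS.preimage a.i))) fun u => u.2,
    gcomp a.j (inclHom S hS), M.res (inclHom _ (hS.preimage a.i)) a.u⟩

theorem codHom_injective {X Y : FinGSet G} {S : Set X.carrier} (hS : Inv S)
    {f : Y.carrier →[G] X.carrier} (h : ∀ y, f y ∈ S) (hf : Function.Injective f) :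
    Function.Injective (codHom S hS f h) :=
  fun _ _ e => hf (congrArg Subtype.val e)

theorem codHom_bijective {X Y : FinGSet G} {S : Set X.carrier} (hS : Inv S)
    {f : Y.carrier →[G] X.carrier} (h : ∀ y, f y ∈ S) (hf : Function.Injective f)
    (hr : S ⊆ Set.range f) : Function.Bijective (codHom S hS f h) :=
  ⟨codHom_injective hS h hf, fun x => by
    obtain ⟨y, hy⟩ := hr x.2
    exact ⟨y, Subtype.ext hy⟩⟩

namespace Presentation

variable {M : Mackey G} (P : Presentation M)

theorem c_ptPre {U U' : FinGSet G} (f : U'.carrier →[G] U.carrier) (hf : Function.Bijective f)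
    (u : M.obj U) :
    P.c _ (ptPre M.toSemiMackey U u) = P.c _ (ptPre M.toSemiMackey U' (M.res f u)) :=
  P.c_iso f (gid G _) hf Function.bijective_id (fun _ => rfl) (fun _ => rfl) rfl

theorem c_restrPre_univ {X : FinGSet G} (a : PreT M.toSemiMackey X) :
    P.c X a = P.c X (restrPre a Set.univ Inv.univ) :=
  P.c_iso (inclHom _ _) (inclHom _ _)
    ⟨inclHom_injective _ _, fun u => ⟨⟨u, trivial⟩, rfl⟩⟩
    ⟨inclHom_injective _ _, fun v => ⟨⟨v, trivial⟩, rfl⟩⟩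
    (fun _ => rfl) (fun _ => rfl) rfl

theorem c_restrPre_union {X : FinGSet G} (a : PreT M.toSemiMackey X) {R O : Set a.V.carrier}
    (hR : Inv R) (hO : Inv O) (hd : Disjoint R O) (hRO : Inv (R ∪ O)) :
    P.c X (restrPre a (R ∪ O) hRO) =
      P.T.add (P.c X (restrPre a R hR)) (P.c X (restrPre a O hO)) := by
  rw [← P.map_add]
  refine P.c_iso (sumElimHom
      (codHom _ (hRO.preimage a.i) (inclHom _ (hR.preimage a.i)) fun x => Or.inl x.2)
      (codHom _ (hRO.preimage a.i) (inclHom _ (hO.preimage a.i)) fun x => Or.inr x.2))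
    (sumElimHom
      (codHom (R ∪ O) hRO (inclHom R hR) fun x => Or.inl x.2)
      (codHom (R ∪ O) hRO (inclHom O hO) fun x => Or.inr x.2))
    (sumElim_incl_bijective (hR.preimage a.i) (hO.preimage a.i) (hd.preimage a.i))
    (sumElim_incl_bijective hR hO hd) ?_ ?_ ?_
  · rintro (u | u) <;> rfl
  · rintro (u | u) <;> rfl
  · refine SemiMackey.sum_ext _ ?_ ?_
    · refine (M.res_comp _ _ _).trans ((M.res_comp _ _ _).trans ?_)
      exact (M.res_inl_pairElt _ _).symm
    · refine (M.res_comp _ _ _).trans ((M.res_comp _ _ _).trans ?_)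
      exact (M.res_inr_pairElt _ _).symm

theorem c_restrPre_orbit (a : PreT M.toSemiMackey (ptG G)) (x : a.V.carrier)
    (hx : x ∉ fixedPts a.V) :
    ∃ K : Subgroup G, K ≠ ⊤ ∧ ∃ y, P.c _ (restrPre a (MulAction.orbit G x) (Inv.orbit x)) =
      P.T.tr (toPtHom (quotG G K)) y := by
  let K := MulAction.stabilizer G x
  let e : (quotG G K).carrier →[G] a.V.carrier := ofFix x fun g hg => hg
  have he : e (bp K) = x := ofFix_bp x fun g hg => hg
  have hinj : Function.Injective e := hom_quot_injective e fun g hg => by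
    rw [he] at hg
    exact hg
  have hr : Set.range e = MulAction.orbit G x := by rw [range_hom_quot, he]
  have hb := codHom_bijective (Inv.orbit x) (f := e) (fun y => hr ▸ Set.mem_range_self y) hinj
    hr.symm.subset
  let b := restrPre a (MulAction.orbit G x) (Inv.orbit x)
  refine ⟨K, fun h => hx fun g => ?_, P.c _ ⟨b.U, quotG G K, gcomp (invHom _ hb) b.i,
    gid G _, b.u⟩, ?_⟩
  · have : g ∈ K := h ▸ Subgroup.mem_top g
    exact this
  · rw [← P.map_tr]
    exact P.c_iso (gid G _) _ Function.bijective_id hb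
      (fun u => (apply_invHom _ hb _).symm) (fun _ => rfl) (M.res_id _)

theorem c_restrPre_singleton (a : PreT M.toSemiMackey (ptG G)) {x : a.V.carrier}
    (hx : x ∈ fixedPts a.V) {S : Set a.V.carrier} (hS : Inv S) (hSx : S = {x}) :
    P.c _ (restrPre a S hS) = P.c _ (ptPre M.toSemiMackey (subG (a.i ⁻¹' {x}) (Inv.fiber a.i hx))
      (M.res (inclHom _ (Inv.fiber a.i hx)) a.u)) := by
  subst hSx
  refine P.c_iso (gid G _) (⟨fun _ => ⟨x, rfl⟩, fun g _ => Subtype.ext (hx g).symm⟩ :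
    (ptG G).carrier →[G] (subG {x} hS).carrier) Function.bijective_id
    ⟨fun _ _ _ => rfl, fun y => ⟨star G, Subtype.ext y.2.symm⟩⟩ (fun u => Subtype.ext u.2)
    (fun _ => rfl) (M.res_id _)

theorem c_ptPre_sum {U U' : FinGSet G} (u : M.obj U) (u' : M.obj U') :
    P.c _ (ptPre M.toSemiMackey (sumG U U') (M.pairElt u u')) =
      P.T.mul (P.c _ (ptPre M.toSemiMackey U u)) (P.c _ (ptPre M.toSemiMackey U' u')) := by
  rw [← P.c_mul]
  let σ : Sec (sumMapHom (gid G (ptG G).carrier) (gid G (ptG G).carrier)) (foldHom (ptG G)) :=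
    ⟨star G, fun y _ => y, by rintro (_ | _) _ <;> rfl⟩
  have hσ : ∀ τ : Sec (sumMapHom (gid G (ptG G).carrier) (gid G (ptG G).carrier))
      (foldHom (ptG G)), τ = σ := fun τ => Sec.ext' rfl fun y h h' => by
    refine Eq.trans ?_ (τ.isSec y h)
    generalize τ.sec y h = z
    rcases z with _ | _ <;> rfl
  let N := normPre M.toSemiMackey (foldHom (ptG G)) (boxPre M.toSemiMackey
    (ptPre M.toSemiMackey U u) (ptPre M.toSemiMackey U' u'))
  let g : (ptG G).carrier →[G] N.V.carrier := ⟨fun _ => σ, fun _ _ => (hσ _).symm⟩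
  let f : (sumG U U').carrier →[G] N.U.carrier :=
    ⟨fun x => ⟨(x, ⟨(sumMapHom (toPtHom U) (toPtHom U') x, σ), rfl⟩), rfl⟩, fun γ x =>
      Subtype.ext (Prod.ext rfl (Subtype.ext (Prod.ext (MulActionHom.map_smul _ γ x)
        (hσ _).symm)))⟩
  refine (P.c_iso (a := N) (b := ptPre M.toSemiMackey (sumG U U') (M.pairElt u u')) f g
    ⟨fun x x' h => congrArg (fun q => q.1.1) h, ?_⟩
    ⟨fun _ _ _ => rfl, fun τ => ⟨star G, (hσ τ).symm⟩⟩
    (fun _ => rfl) (fun _ => rfl) ?_).symm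
  · rintro ⟨⟨x, ⟨⟨y, τ⟩, hy⟩⟩, hx⟩
    refine ⟨x, Subtype.ext (Prod.ext rfl (Subtype.ext (Prod.ext ?_ (hσ _).symm)))⟩
    obtain rfl := hσ τ
    exact hx
  · exact (M.res_comp _ _ _).trans (M.res_id _)

theorem c_ptPre_empty (x : M.obj (emptyG G)) :
    P.c _ (ptPre M.toSemiMackey (emptyG G) x) = P.T.one (ptG G) := by
  rw [← P.c_one (emptyPre M.toSemiMackey (emptyG G))]
  let σ : Sec (initHom (emptyG G)) (initHom (ptG G)) :=
    ⟨star G, fun y _ => y, fun y => y.elim⟩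
  have hσ : ∀ τ : Sec (initHom (emptyG G)) (initHom (ptG G)), τ = σ := fun τ =>
    Sec.ext' rfl fun y => y.elim
  let N := normPre M.toSemiMackey (initHom (ptG G)) (emptyPre M.toSemiMackey (emptyG G))
  exact (P.c_iso (a := N) (b := ptPre M.toSemiMackey (emptyG G) x) (initHom _)
    ⟨fun _ => σ, fun _ _ => (hσ _).symm⟩
    ⟨fun y => y.elim, fun y => y.1.1.elim⟩ ⟨fun _ _ _ => rfl, fun τ => ⟨star G, (hσ τ).symm⟩⟩
    (fun y => y.elim) (fun _ => rfl) (M.toSemiMackey.empty_eq _ _)).symm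

section Additive

variable {A : Type*} [AddCommGroup A] (F : P.T.obj (ptG G) → A)

open Classical in
/-- The value of `F` on the norm of `u` restricted to an invariant subset. -/
noncomputable def setVal {U : FinGSet G} (u : M.obj U) (R : Set U.carrier) : A :=
  if h : Inv R then F (P.c _ (ptPre M.toSemiMackey (subG R h) (M.res (inclHom R h) u))) else 0

theorem setVal_of_inv {U : FinGSet G} (u : M.obj U) {R : Set U.carrier} (h : Inv R) :
    P.setVal F u R = F (P.c _ (ptPre M.toSemiMackey (subG R h) (M.res (inclHom R h) u))) :=
  dif_pos h

theorem setVal_range {U U' : FinGSet G} (u : M.obj U) (f : U'.carrier →[G] U.carrier)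
    (hf : Function.Injective f) :
    P.setVal F u (Set.range f) = F (P.c _ (ptPre M.toSemiMackey U' (M.res f u))) := by
  rw [P.setVal_of_inv F u (Inv.range f), P.c_ptPre (codHom _ (Inv.range f) f fun y => ⟨y, rfl⟩)
    (codHom_bijective _ _ hf subset_rfl), M.res_comp]
  rfl

theorem setVal_res {U U' : FinGSet G} (u : M.obj U) (f : U'.carrier →[G] U.carrier)
    {R : Set U'.carrier} (hR : Inv R) (hf : Set.InjOn f R) :
    P.setVal F (M.res f u) R = P.setVal F u (f '' R) := by
  have h := P.setVal_range F u (gcomp f (inclHom R hR)) fun x y hxy =>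
    Subtype.ext (hf x.2 y.2 hxy)
  have hr : Set.range (gcomp f (inclHom R hR)) = f '' R := by
    rw [show Set.range (gcomp f (inclHom R hR)) = f '' Set.range (inclHom R hR) from
      Set.range_comp f (inclHom R hR), range_inclHom]
  rw [hr] at h
  rw [h, P.setVal_of_inv F _ hR, M.res_comp]

variable {F} (hadd : ∀ x y, F (P.T.add x y) = F x + F y)
  (htr : ∀ (K : Subgroup G), K ≠ ⊤ → ∀ y, F (P.T.tr (toPtHom (quotG G K)) y) = 0)
include hadd htr

theorem apply_c_restrPre (a : PreT M.toSemiMackey (ptG G)) (S : Set a.V.carrier) (hS : Inv S) :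
    ∀ hS' : Inv S, F (P.c _ (restrPre a S hS')) =
      ∑ᶠ v ∈ fixedPts a.V ∩ S, P.setVal F a.u (a.i ⁻¹' {v}) := by
  refine inv_induction (p := fun S => ∀ hS' : Inv S, F (P.c _ (restrPre a S hS')) =
      ∑ᶠ v ∈ fixedPts a.V ∩ S, P.setVal F a.u (a.i ⁻¹' {v})) ?_ ?_ S hS
  · intro h
    have h1 := P.c_restrPre_union a h h (Set.disjoint_empty _) (h.union h)
    have h2 := congrArg F h1
    rw [hadd] at h2
    rw [Set.inter_empty, finsum_mem_empty]
    simp only [Set.union_empty] at h2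
    exact left_eq_add.1 h2
  · intro R x hR ih hd hS'
    rw [P.c_restrPre_union a hR (Inv.orbit x) hd, hadd, ih hR, Set.inter_union_distrib_left,
      finsum_mem_union (hd.mono Set.inter_subset_right Set.inter_subset_right) (Set.toFinite _)
        (Set.toFinite _)]
    congr 1
    by_cases hx : x ∈ fixedPts a.V
    · have ho : MulAction.orbit G x = {x} := by
        ext y
        constructor
        · rintro ⟨g, rfl⟩
          exact hx g
        · rintro rfl
          exact MulAction.mem_orbit_self _
      rw [P.c_restrPre_singleton a hx (Inv.orbit x) ho, ← P.setVal_of_inv F, ho,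
        Set.inter_eq_right.2 (Set.singleton_subset_iff.2 hx), finsum_mem_singleton]
    · obtain ⟨K, hK, y, hy⟩ := P.c_restrPre_orbit a x hx
      rw [hy, htr K hK]
      have he : fixedPts a.V ∩ MulAction.orbit G x = ∅ := by
        rw [Set.eq_empty_iff_forall_notMem]
        rintro z ⟨hz, hzx⟩
        obtain ⟨g, hg⟩ := mem_orbit_of_mem hzx
        have hzx' : z = x := (hz g).symm.trans hg
        exact hx (hzx' ▸ hz)
      rw [he, finsum_mem_empty]

/-- Modulo transfers, a transfer of a norm is the sum of the norms over the fixed points. -/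
theorem apply_c (a : PreT M.toSemiMackey (ptG G)) :
    F (P.c _ a) = ∑ᶠ v ∈ fixedPts a.V, P.setVal F a.u (a.i ⁻¹' {v}) := by
  rw [P.c_restrPre_univ, P.apply_c_restrPre hadd htr a _ Inv.univ, Set.inter_univ]

theorem apply_c_ptPre_tr_of_isDistributor {W U E B : FinGSet G} (k : W.carrier →[G] U.carrier)
    {f : E.carrier →[G] W.carrier} {g : E.carrier →[G] B.carrier}
    {h : B.carrier →[G] (ptG G).carrier} (hd : IsDistributor k (toPtHom U) f g h) (w : M.obj W) :
    F (P.c _ (ptPre M.toSemiMackey U (M.tr k w))) =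
      ∑ᶠ R ∈ lifts k Set.univ, P.setVal F w R := by
  obtain ⟨hinj, hbij⟩ := bijOn_fixed_lifts hd (v := star G) fun _ => rfl
  rw [show {b | b ∈ fixedPts B ∧ h b = star G} = fixedPts B from
      Set.ext fun b => and_iff_left rfl,
    show (toPtHom U) ⁻¹' {star G} = Set.univ from Set.eq_univ_of_forall fun _ => rfl] at hbij
  have hs := STRel.distrib (M := M.toSemiMackey) k (toPtHom U) (gid G (ptG G).carrier) f g h hd w
  refine (congrArg F (P.rel _ _ _ (Quot.sound hs))).trans
    ((P.apply_c hadd htr _).trans (finsum_mem_eq_of_bijOn _ hbij fun b hb => ?_))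
  exact P.setVal_res F w f (Inv.fiber g hb) (hinj b)

/-- Modulo transfers, the norm of a transfer is the sum of the norms over all lifts. -/
theorem apply_c_ptPre_tr {W U : FinGSet G} (k : W.carrier →[G] U.carrier) (w : M.obj W) :
    F (P.c _ (ptPre M.toSemiMackey U (M.tr k w))) =
      ∑ᶠ R ∈ lifts k Set.univ, P.setVal F w R :=
  P.apply_c_ptPre_tr_of_isDistributor hadd htr (E := mkG G (ECan k (toPtHom U)))
    (B := mkG G (Sec k (toPtHom U))) k
    (f := evalHom k (toPtHom U)) (g := pi2Hom k (toPtHom U)) (h := pHom k (toPtHom U))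
    ⟨Equiv.refl _, Equiv.refl _, fun _ _ => rfl, fun _ _ => rfl, fun _ => rfl, fun _ => rfl,
      fun _ => rfl⟩ w

/-- Modulo transfers, norms are additive. -/
theorem apply_c_ptPre_add (K : Subgroup G) (x y : M.obj (quotG G K)) :
    F (P.c _ (ptPre M.toSemiMackey (quotG G K) (M.add x y))) =
      F (P.c _ (ptPre M.toSemiMackey (quotG G K) x)) +
        F (P.c _ (ptPre M.toSemiMackey (quotG G K) y)) := by
  have hl : lifts (foldHom (quotG G K)) Set.univ =
      {Set.range (inlHom (quotG G K) (quotG G K)), Set.range (inrHom (quotG G K) (quotG G K))} := by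
    ext T
    constructor
    · rintro ⟨hT, hb⟩
      obtain ⟨t, ht, -⟩ := hb.surjOn (Set.mem_univ (bp K))
      have h := orbit_eq_of_bijOn _ hT hb.injOn ht
      rcases t with t | t <;> obtain ⟨g, rfl⟩ := exists_smul_bp t
      · left
        rw [h, range_hom_quot]
        exact MulAction.orbit_eq_iff.2 ⟨g, rfl⟩
      · right
        rw [h, Set.mem_singleton_iff, range_hom_quot]
        exact MulAction.orbit_eq_iff.2 ⟨g, rfl⟩
    · rintro (rfl | rfl)
      · exact ⟨Inv.range _, fun _ _ => trivial,
          by rintro _ ⟨p, rfl⟩ _ ⟨q, rfl⟩ h; exact congrArg Sum.inl h,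
          fun p _ => ⟨Sum.inl p, ⟨p, rfl⟩, rfl⟩⟩
      · exact ⟨Inv.range _, fun _ _ => trivial,
          by rintro _ ⟨p, rfl⟩ _ ⟨q, rfl⟩ h; exact congrArg Sum.inr h,
          fun p _ => ⟨Sum.inr p, ⟨p, rfl⟩, rfl⟩⟩
  have hne : Set.range (inlHom (quotG G K) (quotG G K)) ≠
      Set.range (inrHom (quotG G K) (quotG G K)) := by
    intro h
    obtain ⟨y, hy⟩ := h.subset ⟨bp K, rfl⟩
    exact Sum.inr_ne_inl hy
  have h := P.apply_c_ptPre_tr hadd htr (foldHom (quotG G K)) (M.pairElt x y)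
  rw [hl, finsum_mem_pair hne, P.setVal_range F _ _ (inlHom_injective _ _),
    P.setVal_range F _ _ (inrHom_injective _ _), M.res_inl_pairElt, M.res_inr_pairElt] at h
  exact h

theorem apply_c_ptPre_projHom {K H : Subgroup G} (hK : K < H) (y : M.obj (quotG G K)) :
    F (P.c _ (ptPre M.toSemiMackey (quotG G H) (M.tr (projHom hK.le) y))) = 0 := by
  rw [P.apply_c_ptPre_tr hadd htr]
  have hl : lifts (projHom hK.le) Set.univ = ∅ := by
    rw [Set.eq_empty_iff_forall_notMem]
    rintro T ⟨hT, hb⟩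
    obtain ⟨t, ht, -⟩ := hb.surjOn (Set.mem_univ (bp H))
    obtain ⟨g, hgH, hgK⟩ := SetLike.exists_of_lt hK
    obtain ⟨a, rfl⟩ := exists_smul_bp t
    have hbp : bp K ∈ T := (hT.mem_smul_iff a _).1 ht
    refine hgK ((smul_bp_eq g).1 (hb.injOn (hT g _ hbp) hbp ?_))
    rw [MulActionHom.map_smul]
    exact (smul_bp_eq g).2 hgH
  rw [hl, finsum_mem_empty]

theorem apply_c_ptPre_zero (K : Subgroup G) :
    F (P.c _ (ptPre M.toSemiMackey (quotG G K) (M.zero _))) = 0 := by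
  have h := P.apply_c_ptPre_add hadd htr K (M.zero _) (M.zero _)
  rw [M.zero_add'] at h
  exact left_eq_add.1 h

theorem apply_c_transSetM {K : Subgroup G} {s : M.obj (quotG G K)} (h : TransSetM M K s) :
    F (P.c _ (ptPre M.toSemiMackey (quotG G K) s)) = 0 := by
  induction h with
  | zero => exact P.apply_c_ptPre_zero hadd htr K
  | tr K' hK' y => exact P.apply_c_ptPre_projHom hadd htr hK' y
  | add _ _ ih ih' => rw [P.apply_c_ptPre_add hadd htr, ih, ih', add_zero]

theorem apply_c_relPhiM {K : Subgroup G} {x y : M.obj (quotG G K)} (h : relPhiM M K x y) :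
    F (P.c _ (ptPre M.toSemiMackey (quotG G K) x)) =
      F (P.c _ (ptPre M.toSemiMackey (quotG G K) y)) := by
  obtain ⟨s, t, hs, ht, h⟩ := h
  have h' := congrArg (fun z => F (P.c _ (ptPre M.toSemiMackey (quotG G K) z))) h
  rwa [P.apply_c_ptPre_add hadd htr, P.apply_c_ptPre_add hadd htr,
    P.apply_c_transSetM hadd htr hs, P.apply_c_transSetM hadd htr ht, add_zero, add_zero] at h'

end Additive

theorem c_relWM {K : Subgroup G} {x y : M.obj (quotG G K)} (h : relWM M K x y) :
    P.c _ (ptPre M.toSemiMackey (quotG G K) x) = P.c _ (ptPre M.toSemiMackey (quotG G K) y) := by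
  obtain ⟨w, hw, rfl⟩ := h
  exact P.c_ptPre _ w.bijective x

section Multiplicative

variable {ι S : Type} [CommRing S] (D : FixChar M ι S) {F : P.T.obj (ptG G) → S}
  (hmul : ∀ x y, F (P.T.mul x y) = F x * F y) (hone : F (P.T.one (ptG G)) = 1)
  (hXi : ∀ (i : ι) (x : M.obj (quotG G (D.H i))), F (P.c _ (XiPre M (D.H i) x)) = D.ψ i x)
include hmul hone hXi

theorem setVal_eq_prod {U : FinGSet G} (u : M.obj U) (R : Set U.carrier) (hR : Inv R) :
    P.setVal F u R = D.prod u R := by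
  refine inv_induction (p := fun R => P.setVal F u R = D.prod u R) ?_ ?_ R hR
  · have hr : (∅ : Set U.carrier) = Set.range (initHom U) := by
      rw [eq_comm, Set.eq_empty_iff_forall_notMem]
      rintro _ ⟨y, -⟩
      exact y.elim
    have hi : Function.Injective (initHom U) := fun y => y.elim
    rw [D.prod_empty, hr, P.setVal_range F u _ hi, P.c_ptPre_empty, hone]
  · intro R x hR ih hd
    have hO := Inv.orbit x
    rw [D.prod_union u hR hd, ← ih]
    have h1 : P.setVal F u (MulAction.orbit G x) = D.prod u (MulAction.orbit G x) := by
      obtain ⟨i, f, hf, hr⟩ := D.exists_chart x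
      rw [← hr, D.prod_range u f hf, P.setVal_range F u f hf]
      exact hXi i _
    rw [← h1, P.setVal_of_inv F u hR, P.setVal_of_inv F u hO, P.setVal_of_inv F u (hR.union hO),
      ← hmul, ← P.c_ptPre_sum, P.c_ptPre _ (sumElim_incl_bijective hR hO hd)]
    congr 3
    refine SemiMackey.sum_ext _ ?_ ?_
    · refine (M.res_comp _ _ _).trans ((M.res_comp _ _ _).trans ?_)
      exact (M.res_inl_pairElt _ _).symm
    · refine (M.res_comp _ _ _).trans ((M.res_comp _ _ _).trans ?_)
      exact (M.res_inr_pairElt _ _).symm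

variable (hadd : ∀ x y, F (P.T.add x y) = F x + F y)
  (htr : ∀ (K : Subgroup G), K ≠ ⊤ → ∀ y, F (P.T.tr (toPtHom (quotG G K)) y) = 0)
include hadd htr

theorem eq_ext : F = P.ext D := by
  have hc : ∀ a, F (P.c _ a) = D.ev a := fun a => by
    rw [P.apply_c hadd htr, FixChar.ev]
    exact finsum_mem_congr rfl fun v hv =>
      P.setVal_eq_prod D hmul hone hXi _ _ (Inv.fiber a.i hv)
  funext t
  obtain ⟨a, b, h⟩ := P.sur _ t
  have h' := congrArg F h
  rw [hadd, hc, hc] at h'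
  rw [P.ext_eq D h, ← h', add_sub_cancel_right]

end Multiplicative

end Presentation

/-- Modulo transfers from proper subgroups, `T(G/G)` is an abelian group. -/
theorem exists_addCommGroup_relPhiT (T : Tambara G) :
    ∃ (A : Type 1) (_ : AddCommGroup A) (F : T.obj (ptG G) → A),
      (∀ x y, F (T.toSemiMackey.add x y) = F x + F y) ∧
      (∀ K : Subgroup G, K ≠ ⊤ → ∀ y, F (T.tr (toPtHom (quotG G K)) y) = 0) ∧
      ∀ x y, F x = F y → relPhiT T x y := by
  let := T.addCommGroup (ptG G)
  let N : AddSubgroup (T.obj (ptG G)) :=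
    { carrier := {x | ∃ s t, TransSetT T s ∧ TransSetT T t ∧ x + s = t}
      zero_mem' := ⟨_, _, .zero, .zero, zero_add _⟩
      add_mem' := by
        rintro x y ⟨s, t, hs, ht, rfl⟩ ⟨s', t', hs', ht', rfl⟩
        exact ⟨_, _, .add hs hs', .add ht ht', add_add_add_comm x y s s'⟩
      neg_mem' := by
        rintro x ⟨s, t, hs, ht, rfl⟩
        exact ⟨_, _, ht, hs, neg_add_cancel_left x s⟩ }
  refine ⟨T.obj (ptG G) ⧸ N, inferInstance, QuotientAddGroup.mk, fun _ _ => rfl,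
    fun K hK y => (QuotientAddGroup.eq_zero_iff _).2 ⟨_, _, .zero, .tr K hK y, add_zero _⟩,
    fun x y h => ?_⟩
  obtain ⟨s, t, hs, ht, h⟩ := QuotientAddGroup.eq.1 h
  refine ⟨t, s, ht, hs, ?_⟩
  show x + t = y + s
  rw [← h, ← add_assoc, add_neg_cancel_left]

theorem degN_XiPre (M : Mackey G) (K : Subgroup G) (x : M.obj (quotG G K)) :
    DegN (Nat.card (G ⧸ K)) (XiPre M K x) := fun v =>
  Nat.card_congr (Equiv.subtypeUnivEquiv fun _ => rfl)

/-- Let `M` be a Mackey functor, `(T, c)` the free Tambara functor on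
`M` (the levelwise additive completion of `sT(M)`), and `H₁, …, H_r` a list of subgroups
of `G` containing exactly one from each conjugacy class.  For each subgroup `K` the
assignment `[x] ↦ [n_K^G θ_M(x)]` gives a well-defined homomorphism of abelian groups
`Ξ_M(K) : (Φ^K M)/W(K) → Φ^G T^{|G/K|}(M)`, and the induced graded ring homomorphism
`Ξ_M : Sym(⊕ᵢ (Φ^{Hᵢ} M)/W(Hᵢ)) → Φ^G T(M)` is an isomorphism of graded rings — here
expressed by saying that `Φ^G T(M)`, with the maps `Ξ_M(Hᵢ)`, satisfies the universal
property of the symmetric algebra on `⊕ᵢ (Φ^{Hᵢ} M)/W(Hᵢ)`. -/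
theorem statement9 (M : Mackey G)
    (T : Tambara G) (c : ∀ X : FinGSet G, PreT M.toSemiMackey X → T.obj X)
    (hc_rel : ∀ (X : FinGSet G) (a b : PreT M.toSemiMackey X),
      Quot.mk (STRel M.toSemiMackey X) a = Quot.mk (STRel M.toSemiMackey X) b →
        c X a = c X b)
    (hc_tr : ∀ {X Y : FinGSet G} (f : X.carrier →[G] Y.carrier) (a : PreT M.toSemiMackey X),
      c Y (trPre M.toSemiMackey f a) = T.tr f (c X a))
    (hc_res : ∀ {X Y : FinGSet G} (f : Y.carrier →[G] X.carrier) (a : PreT M.toSemiMackey X),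
      c Y (resPre M.toSemiMackey f a) = T.res f (c X a))
    (hc_nm : ∀ {X Y : FinGSet G} (f : X.carrier →[G] Y.carrier) (a : PreT M.toSemiMackey X),
      c Y (normPre M.toSemiMackey f a) = T.nm f (c X a))
    (hc_add : ∀ (X : FinGSet G) (a b : PreT M.toSemiMackey X),
      c X (addPre M.toSemiMackey a b) = T.toSemiMackey.add (c X a) (c X b))
    (hc_sur : ∀ (X : FinGSet G) (t : T.obj X), ∃ a b : PreT M.toSemiMackey X,
      T.toSemiMackey.add t (c X b) = c X a)
    (hc_inj : ∀ (X : FinGSet G) (a b : PreT M.toSemiMackey X),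
      c X a = c X b ↔ ∃ k : PreT M.toSemiMackey X,
        Quot.mk (STRel M.toSemiMackey X) (addPre M.toSemiMackey a k) =
          Quot.mk (STRel M.toSemiMackey X) (addPre M.toSemiMackey b k))
    (hc_free : ∀ (R : Tambara G) (φ : SMackHom M.toSemiMackey R.toSemiMackey),
      ∃! F : STambHom T.toSemiTambara R.toSemiTambara,
        ∀ (X : FinGSet G) (x : M.obj X),
          F.app X (c X (thetaPre M.toSemiMackey X x)) = φ.app X x)
    (ι : Type) [Fintype ι] (H : ι → Subgroup G)
    (hH : ∀ K : Subgroup G, ∃! i : ι,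
      ∃ g : G, Subgroup.map (MulAut.conj g).toMonoidHom K = H i) :
    -- `Ξ_M(K)` is well defined on `(Φ^K M)/W(K)` ...
    (∀ (K : Subgroup G) (x y : M.obj (quotG G K)),
      (relPhiM M K x y ∨ relWM M K x y) →
        Quot.mk (relPhiT T) (c _ (XiPre M K x)) = Quot.mk (relPhiT T) (c _ (XiPre M K y))) ∧
    -- ... is a homomorphism of abelian groups ...
    (∀ (K : Subgroup G) (x y : M.obj (quotG G K)),
      Quot.mk (relPhiT T) (c _ (XiPre M K (M.toSemiMackey.add x y))) =
        Quot.mk (relPhiT T)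
          (T.toSemiMackey.add (c _ (XiPre M K x)) (c _ (XiPre M K y)))) ∧
    -- ... and lands in the degree-`|G/K|` part:
    (∀ (K : Subgroup G) (x : M.obj (quotG G K)), DegN (Nat.card (G ⧸ K)) (XiPre M K x)) ∧
    -- `Φ^G T(M)` is the free symmetric algebra (free commutative ring) on the
    -- `(Φ^{Hᵢ} M)/W(Hᵢ)`:
    (∀ (S : Type) [CommRing S] (ψ : ∀ i : ι, M.obj (quotG G (H i)) → S),
      (∀ (i : ι) (x y : M.obj (quotG G (H i))),
        (relPhiM M (H i) x y ∨ relWM M (H i) x y) → ψ i x = ψ i y) →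
      (∀ (i : ι) (x y : M.obj (quotG G (H i))),
        ψ i (M.toSemiMackey.add x y) = ψ i x + ψ i y) →
      ∃! F : T.obj (ptG G) → S,
        (∀ a b, relPhiT T a b → F a = F b) ∧
        (∀ a b, F (T.toSemiMackey.add a b) = F a + F b) ∧
        (∀ a b, F (T.toSemiTambara.mul a b) = F a * F b) ∧
        F (T.toSemiTambara.one (ptG G)) = 1 ∧
        (∀ (i : ι) (x : M.obj (quotG G (H i))), F (c _ (XiPre M (H i) x)) = ψ i x)) := by
  let P : Presentation M := ⟨T, c, hc_rel, hc_tr, hc_res, hc_nm, hc_add, hc_sur, hc_inj⟩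
  obtain ⟨A, _, Q, hQadd, hQtr, hQ⟩ := exists_addCommGroup_relPhiT T
  have hsound : ∀ x y, Q x = Q y → Quot.mk (relPhiT T) x = Quot.mk (relPhiT T) y :=
    fun x y h => Quot.sound (hQ x y h)
  refine ⟨fun K x y h => h.elim (fun h => ?_) fun h => ?_, fun K x y => ?_,
    fun K x => degN_XiPre M K x, fun S _ ψ hψ hψadd => ?_⟩
  · exact hsound _ _ (P.apply_c_relPhiM hQadd hQtr h)
  · exact congrArg _ (P.c_relWM h)
  · exact hsound _ _ ((P.apply_c_ptPre_add hQadd hQtr K x y).trans (hQadd _ _).symm)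
  · let D : FixChar M ι S := ⟨H, hH, ψ, hψ, hψadd⟩
    refine ⟨P.ext D, ⟨fun _ _ => P.ext_rel D, P.ext_add D, P.ext_mul D, P.ext_one D,
      P.ext_Xi D⟩, ?_⟩
    rintro F ⟨hrel, hadd, hmul, hone, hXi⟩
    refine P.eq_ext D hmul hone hXi hadd fun K hK y => ?_
    have hzero : F (T.toSemiMackey.zero (ptG G)) = 0 := by
      have h := hadd (T.toSemiMackey.zero _) (T.toSemiMackey.zero _)
      rw [T.toSemiMackey.zero_add'] at h
      exact left_eq_add.1 h
    rw [← hzero]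
    refine hrel _ _ ⟨_, _, .zero, .tr K hK y, ?_⟩
    exact T.toSemiMackey.add_comm' _ _

end Statement9
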